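/- arXiv:2305.03600 — 4 statements merged into one kernel-verified Lean document; each statement's English description precedes it below -/
import Mathlib

section
/- Let d be a real number with 0 ≤ d < 1/2. Then the triple integral of |x₁−x₂|^(−d)·|x₂−x₃|^(−d)·|x₃−x₁|^(−d) over the cube [0,1]³ equals 6·Γ(1−d)²·Γ(2−3d)/(Γ(2−2d)·Γ(4−3d)). Consequently the third cumulant of the Rosenblatt distribution satisfies κ₃(d) = 48·((1/2)(1−2d)(1−d))^(3/2) · Γ(1−d)²Γ(2−3d)/(Γ(2−2d)Γ(4−3d)). -/
open Real

noncomputable def poch (a : ℝ) (k : ℕ) : ℝ := ∏ i ∈ Finset.range k, (a + i)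

noncomputable def F21 (a b c x : ℝ) : ℝ :=
  ∑' k : ℕ, poch a k * poch b k / (poch c k * (Nat.factorial k : ℝ)) * x ^ k

noncomputable def F32 (a b c e f : ℝ) : ℝ :=
  ∑' k : ℕ, poch a k * poch b k * poch c k / (poch e k * poch f k * (Nat.factorial k : ℝ))

noncomputable def F32x (a b c e f x : ℝ) : ℝ :=
  ∑' k : ℕ, poch a k * poch b k * poch c k / (poch e k * poch f k * (Nat.factorial k : ℝ)) * x ^ k

noncomputable def F43 (a b c g e f h : ℝ) : ℝ :=
  ∑' k : ℕ, poch a k * poch b k * poch c k * poch g k /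
    (poch e k * poch f k * poch h k * (Nat.factorial k : ℝ))

noncomputable def c3 (d : ℝ) : ℝ :=
  ∫ x1 in (0:ℝ)..1, ∫ x2 in (0:ℝ)..1, ∫ x3 in (0:ℝ)..1,
    |x1 - x2| ^ (-d) * |x2 - x3| ^ (-d) * |x3 - x1| ^ (-d)

open MeasureTheory Set

noncomputable def J3 (μ : Measure ℝ) (Q : ℝ → ℝ → ℝ → ENNReal) : ENNReal :=
  ∫⁻ x, ∫⁻ y, ∫⁻ z, Q x y z ∂μ ∂μ ∂μ

def M3 (Q : ℝ → ℝ → ℝ → ENNReal) : Prop :=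
  Measurable (fun p : ℝ × ℝ × ℝ => Q p.1 p.2.1 p.2.2)

lemma M3.comp {Q : ℝ → ℝ → ℝ → ENNReal} (h : M3 Q) {α : Type*} [MeasurableSpace α]
    {f g k : α → ℝ} (hf : Measurable f) (hg : Measurable g) (hk : Measurable k) :
    Measurable (fun a => Q (f a) (g a) (k a)) :=
  Measurable.comp h (hf.prodMk (hg.prodMk hk))

lemma M3.inner {Q : ℝ → ℝ → ℝ → ENNReal} (h : M3 Q) (μ : Measure ℝ) [SFinite μ] :
    Measurable (fun p : ℝ × ℝ => ∫⁻ z, Q p.1 p.2 z ∂μ) := by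
  apply Measurable.lintegral_prod_right' (f := fun q : (ℝ × ℝ) × ℝ => Q q.1.1 q.1.2 q.2)
  exact h.comp (by fun_prop) (by fun_prop) (by fun_prop)

lemma M3.inner2 {Q : ℝ → ℝ → ℝ → ENNReal} (h : M3 Q) (μ : Measure ℝ) [SFinite μ] :
    Measurable (fun x : ℝ => ∫⁻ y, ∫⁻ z, Q x y z ∂μ ∂μ) :=
  Measurable.lintegral_prod_right' (h.inner μ)

lemma swap23 (μ : Measure ℝ) [SFinite μ] {Q : ℝ → ℝ → ℝ → ENNReal} (h : M3 Q) :
    J3 μ (fun x y z => Q x z y) = J3 μ Q := by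
  unfold J3
  refine lintegral_congr fun x => ?_
  apply lintegral_lintegral_swap
  exact (h.comp (by fun_prop) (by fun_prop) (by fun_prop) :
    Measurable (fun p : ℝ × ℝ => Q x p.2 p.1)).aemeasurable

lemma swap12 (μ : Measure ℝ) [SFinite μ] {Q : ℝ → ℝ → ℝ → ENNReal} (h : M3 Q) :
    J3 μ (fun x y z => Q y x z) = J3 μ Q := by
  unfold J3
  apply lintegral_lintegral_swap (f := fun x y => ∫⁻ z, Q y x z ∂μ)
  exact ((h.inner μ).comp measurable_swap).aemeasurable

lemma J3_symm (μ : Measure ℝ) [SFinite μ] [NullSingletonClass μ] {F : ℝ → ℝ → ℝ → ENNReal} (h : M3 F)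
    (h12 : ∀ x y z, F y x z = F x y z) (h23 : ∀ x y z, F x z y = F x y z) :
    J3 μ F = 6 * J3 μ (fun x y z => if x < z ∧ z < y then F x y z else 0) := by
  set P : ℝ → ℝ → ℝ → ENNReal := fun x y z => if x < z ∧ z < y then F x y z else 0 with hP
  have mP : M3 P := by
    unfold M3
    refine Measurable.ite ?_ h measurable_const
    have u1 : MeasurableSet {p : ℝ × ℝ × ℝ | p.1 < p.2.2} :=
      measurableSet_lt (by fun_prop) (by fun_prop)
    have u2 : MeasurableSet {p : ℝ × ℝ × ℝ | p.2.2 < p.2.1} :=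
      measurableSet_lt (by fun_prop) (by fun_prop)
    exact u1.inter u2
  have m1 : M3 (fun x y z => P x z y) := mP.comp (by fun_prop) (by fun_prop) (by fun_prop)
  have m2 : M3 (fun x y z => P y x z) := mP.comp (by fun_prop) (by fun_prop) (by fun_prop)
  have m3 : M3 (fun x y z => P y z x) := mP.comp (by fun_prop) (by fun_prop) (by fun_prop)
  have m4 : M3 (fun x y z => P z x y) := mP.comp (by fun_prop) (by fun_prop) (by fun_prop)
  have m5 : M3 (fun x y z => P z y x) := mP.comp (by fun_prop) (by fun_prop) (by fun_prop)
  have e1 := swap23 μ mP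
  have e2 := swap12 μ mP
  have e3 := (swap12 μ m1).trans e1
  have e4 := (swap23 μ m2).trans e2
  have e5 := (swap12 μ m4).trans e4
  have add : ∀ {A B : ℝ → ℝ → ℝ → ENNReal}, M3 A → M3 B →
      M3 (fun x y z => A x y z + B x y z) ∧
      J3 μ (fun x y z => A x y z + B x y z) = J3 μ A + J3 μ B := by
    intro A B hA hB
    refine ⟨Measurable.add hA hB, ?_⟩
    unfold J3
    rw [← lintegral_add_left (hA.inner2 μ)]
    refine lintegral_congr fun x => ?_
    have hx : Measurable (fun y => ∫⁻ z, A x y z ∂μ) :=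
      (hA.inner μ).comp (measurable_prodMk_left (x := x))
    rw [← lintegral_add_left hx]
    refine lintegral_congr fun y => ?_
    have hxy : Measurable (fun z => A x y z) :=
      hA.comp measurable_const measurable_const measurable_id
    rw [← lintegral_add_left hxy]
  have a1 := add mP m1
  have a2 := add a1.1 m2
  have a3 := add a2.1 m3
  have a4 := add a3.1 m4
  have a5 := add a4.1 m5
  have key : J3 μ F = J3 μ (fun x y z => P x y z + P x z y + P y x z + P y z x + P z x y + P z y x) := by
    unfold J3
    refine lintegral_congr fun x => ?_
    refine lintegral_congr_ae ?_
    filter_upwards [(measure_eq_zero_iff_ae_notMem.1 (measure_singleton (μ := μ) x))] with y hy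
    refine lintegral_congr_ae ?_
    filter_upwards [(measure_eq_zero_iff_ae_notMem.1 (measure_singleton (μ := μ) x)),
      (measure_eq_zero_iff_ae_notMem.1 (measure_singleton (μ := μ) y))] with z hz hz'
    simp only [mem_singleton_iff] at hy hz hz'
    have p1 := h23 x y z
    have p2 := h12 x y z
    have p3 : F y z x = F x y z := by rw [h23 y x z, h12]
    have p4 : F z x y = F x y z := by rw [h12 x z y, h23]
    have p5 : F z y x = F x y z := by rw [h12 y z x, p3]
    simp only [hP, p1, p2, p3, p4, p5]
    rcases lt_or_gt_of_ne hy with a | a <;> rcases lt_or_gt_of_ne hz with b | b <;>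
      rcases lt_or_gt_of_ne hz' with c | c <;>
      first
      | (exfalso; linarith)
      | simp [a, b, c, a.not_gt, b.not_gt, c.not_gt]
  rw [key, a5.2, a4.2, a3.2, a2.2, a1.2, e1, e2, e3, e4, e5]
  ring

lemma lint_pow {r c : ℝ} (hr : -1 < r) (hc : 0 ≤ c) :
    ∫⁻ w in Ioc 0 c, ENNReal.ofReal (w ^ r) = ENNReal.ofReal (c ^ (r+1) / (r+1)) := by
  rw [← ofReal_integral_eq_lintegral_ofReal]
  · rw [← intervalIntegral.integral_of_le hc, integral_rpow (Or.inl hr),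
      Real.zero_rpow (by linarith), sub_zero]
  · exact (intervalIntegrable_iff_integrableOn_Ioc_of_le hc).1
      (intervalIntegral.intervalIntegrable_rpow' hr)
  · refine ae_restrict_of_forall_mem measurableSet_Ioc fun x hx => ?_
    exact Real.rpow_nonneg hx.1.le _

lemma lint_scale {c : ℝ} (hc : 0 < c) {H : ℝ → ENNReal} (hH : Measurable H) :
    ∫⁻ w, H w = ENNReal.ofReal c * ∫⁻ t, H (c * t) := by
  conv_lhs => rw [← Real.smul_map_volume_mul_left hc.ne']
  rw [lintegral_smul_measure, lintegral_map hH (by fun_prop), abs_of_pos hc, smul_eq_mul]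

lemma lint_beta {d a b : ℝ} (h1 : d < 1) (hab : a < b) :
    ∫⁻ z, (if a < z ∧ z < b then ENNReal.ofReal ((z - a) ^ (-d) * (b - z) ^ (-d)) else 0)
      = ENNReal.ofReal (ProbabilityTheory.beta (1-d) (1-d) * (b - a) ^ (1 - 2*d)) := by
  have hc : 0 < b - a := by linarith
  have hB := ProbabilityTheory.beta_pos (show 0 < 1 - d by linarith) (show 0 < 1 - d by linarith)
  set c := b - a with hcdef
  set B := ProbabilityTheory.beta (1-d) (1-d)
  set H : ℝ → ENNReal := fun w => if 0 < w ∧ w < c then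
    ENNReal.ofReal (w ^ (-d) * (c - w) ^ (-d)) else 0 with hHd
  have hH : Measurable H := Measurable.ite measurableSet_Ioo (by fun_prop) (by fun_prop)
  have e1 : (fun z => (if a < z ∧ z < b then
      ENNReal.ofReal ((z - a) ^ (-d) * (b - z) ^ (-d)) else 0)) = fun z => H (z - a) := by
    funext z
    simp only [hHd, hcdef, sub_pos, sub_lt_sub_iff_right, sub_sub_sub_cancel_right]
  rw [e1, lintegral_sub_right_eq_self H a, lint_scale hc hH]
  have e2 : ∀ t, H (c * t) = ENNReal.ofReal (B * c ^ (-2*d)) *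
      ProbabilityTheory.betaPDF (1-d) (1-d) t := by
    intro t
    rw [ProbabilityTheory.betaPDF_eq]
    have i1 : (0 < c * t ∧ c * t < c) ↔ (0 < t ∧ t < 1) := by
      rw [mul_pos_iff_of_pos_left hc, mul_lt_iff_lt_one_right hc]
    simp only [hHd, i1]
    split_ifs with ht
    · rw [← ENNReal.ofReal_mul (by positivity)]
      congr 1
      have : c - c * t = c * (1 - t) := by ring
      rw [this, Real.mul_rpow hc.le ht.1.le, Real.mul_rpow hc.le (by linarith [ht.2]),
        show -2*d = -d + -d by ring, Real.rpow_add hc, show 1 - d - 1 = -d by ring]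
      change _ = _ * (1 / B * _ * _)
      field_simp
    · simp
  simp only [e2]
  rw [lintegral_const_mul' _ _ ENNReal.ofReal_ne_top,
    ProbabilityTheory.lintegral_betaPDF_eq_one (by linarith) (by linarith), mul_one,
    ← ENNReal.ofReal_mul hc.le]
  congr 1
  rw [show 1 - 2*d = 1 + -2*d by ring, Real.rpow_add hc, Real.rpow_one]
  ring

lemma J3_val {d : ℝ} (h0 : 0 ≤ d) (h1 : d < 1/2) :
    J3 (volume.restrict (Ioc 0 1)) (fun x y z => if x < z ∧ z < y then
      ENNReal.ofReal (|x - y| ^ (-d) * |y - z| ^ (-d) * |z - x| ^ (-d)) else 0) =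
    ENNReal.ofReal (ProbabilityTheory.beta (1-d) (1-d) / ((2-3*d)*(3-3*d))) := by
  set B := ProbabilityTheory.beta (1-d) (1-d) with hBd
  have hB : 0 < B := ProbabilityTheory.beta_pos (show 0 < 1 - d by linarith) (show 0 < 1 - d by linarith)
  unfold J3
  have s1 : ∀ x ∈ Ioc (0:ℝ) 1, ∀ y ∈ Ioc (0:ℝ) 1,
      ∫⁻ z in Ioc 0 1, (if x < z ∧ z < y then
      ENNReal.ofReal (|x - y| ^ (-d) * |y - z| ^ (-d) * |z - x| ^ (-d)) else 0) =
      (Ioc 0 (1 - x)).indicator (fun w => ENNReal.ofReal B * ENNReal.ofReal (w ^ (1-3*d))) (y - x) := by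
    intro x hx y hy
    by_cases hxy : x < y
    · rw [indicator_of_mem (by constructor <;> linarith [hy.2]),
        ← lintegral_indicator measurableSet_Ioc]
      have : ∀ z, (Ioc (0:ℝ) 1).indicator (fun z => if x < z ∧ z < y then
          ENNReal.ofReal (|x - y| ^ (-d) * |y - z| ^ (-d) * |z - x| ^ (-d)) else 0) z =
          ENNReal.ofReal ((y - x) ^ (-d)) * (if x < z ∧ z < y then
            ENNReal.ofReal ((z - x) ^ (-d) * (y - z) ^ (-d)) else 0) := by
        intro z
        by_cases hz : x < z ∧ z < y
        · rw [indicator_of_mem (by constructor <;> linarith [hy.2, hx.1, hz.1, hz.2]), if_pos hz,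
            if_pos hz, ← ENNReal.ofReal_mul (Real.rpow_nonneg (by linarith) _),
            abs_sub_comm x y, abs_of_pos (sub_pos.2 hxy), abs_of_pos (sub_pos.2 hz.1),
            abs_of_pos (sub_pos.2 hz.2)]
          congr 1
          ring
        · rw [if_neg hz, mul_zero]
          simp [indicator, hz]
      simp only [this]
      rw [lintegral_const_mul' _ _ ENNReal.ofReal_ne_top, lint_beta (by linarith) hxy,
        ← ENNReal.ofReal_mul (Real.rpow_nonneg (by linarith) _), ← ENNReal.ofReal_mul hB.le]
      congr 1
      rw [show 1 - 3*d = -d + (1 - 2*d) by ring, Real.rpow_add (sub_pos.2 hxy)]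
      ring
    · rw [indicator_of_notMem (fun h => hxy (sub_pos.1 h.1))]
      have : ∀ z, ¬ (x < z ∧ z < y) := fun z h => hxy (h.1.trans h.2)
      simp [this]
  have s2 : ∀ x ∈ Ioc (0:ℝ) 1, ∫⁻ y in Ioc 0 1, ∫⁻ z in Ioc 0 1, (if x < z ∧ z < y then
      ENNReal.ofReal (|x - y| ^ (-d) * |y - z| ^ (-d) * |z - x| ^ (-d)) else 0) =
      ENNReal.ofReal B * ENNReal.ofReal ((1 - x) ^ (2 - 3*d) / (2 - 3*d)) := by
    intro x hx
    rw [setLIntegral_congr_fun measurableSet_Ioc (s1 x hx), ← lintegral_indicator measurableSet_Ioc]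
    have : ∀ y, (Ioc (0:ℝ) 1).indicator (fun y => (Ioc 0 (1 - x)).indicator
        (fun w => ENNReal.ofReal B * ENNReal.ofReal (w ^ (1-3*d))) (y - x)) y =
        (fun w => (Ioc 0 (1 - x)).indicator
        (fun w => ENNReal.ofReal B * ENNReal.ofReal (w ^ (1-3*d))) w) (y - x) := by
      intro y
      by_cases hy : y ∈ Ioc (0:ℝ) 1
      · rw [indicator_of_mem hy]
      · rw [indicator_of_notMem hy]
        refine (indicator_of_notMem ?_ _).symm
        intro h
        exact hy ⟨by linarith [h.1, hx.1], by linarith [h.2]⟩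
    simp only [this]
    rw [lintegral_sub_right_eq_self (fun w => (Ioc 0 (1 - x)).indicator
        (fun w => ENNReal.ofReal B * ENNReal.ofReal (w ^ (1-3*d))) w) x,
      lintegral_indicator measurableSet_Ioc, lintegral_const_mul' _ _ ENNReal.ofReal_ne_top,
      lint_pow (by linarith) (by linarith [hx.2]), show 1 - 3*d + 1 = 2 - 3*d by ring]
  rw [setLIntegral_congr_fun measurableSet_Ioc s2, ← restrict_Ioo_eq_restrict_Ioc,
    ← lintegral_indicator measurableSet_Ioo]
  have : ∀ x, (Ioo (0:ℝ) 1).indicator (fun x =>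
      ENNReal.ofReal B * ENNReal.ofReal ((1 - x) ^ (2 - 3*d) / (2 - 3*d))) x =
      (fun w => (Ioo (0:ℝ) 1).indicator (fun w =>
      ENNReal.ofReal (B / (2 - 3*d)) * ENNReal.ofReal (w ^ (2 - 3*d))) w) (1 - x) := by
    intro x
    by_cases hx : x ∈ Ioo (0:ℝ) 1
    · have hx' : 1 - x ∈ Ioo (0:ℝ) 1 := ⟨by linarith [hx.2], by linarith [hx.1]⟩
      simp only [indicator_of_mem hx, indicator_of_mem hx']
      rw [← ENNReal.ofReal_mul hB.le, ← ENNReal.ofReal_mul (div_nonneg hB.le (by linarith))]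
      congr 1
      ring
    · have hx' : 1 - x ∉ Ioo (0:ℝ) 1 := fun h => hx ⟨by linarith [h.2], by linarith [h.1]⟩
      simp only [indicator_of_notMem hx, indicator_of_notMem hx']
  simp only [this]
  rw [lintegral_sub_left_eq_self (fun w => (Ioo (0:ℝ) 1).indicator (fun w =>
      ENNReal.ofReal (B / (2 - 3*d)) * ENNReal.ofReal (w ^ (2 - 3*d))) w) 1,
    lintegral_indicator measurableSet_Ioo, restrict_Ioo_eq_restrict_Ioc,
    lintegral_const_mul' _ _ ENNReal.ofReal_ne_top, lint_pow (by linarith) zero_le_one,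
    ← ENNReal.ofReal_mul (div_nonneg hB.le (by linarith)), Real.one_rpow]
  congr 1
  rw [show 2 - 3*d + 1 = 3 - 3*d by ring, div_mul_div_comm, mul_one]

lemma c3_eq_toReal (d : ℝ) (hfin : J3 (volume.restrict (Ioc 0 1)) (fun x y z =>
      ENNReal.ofReal (|x - y| ^ (-d) * |y - z| ^ (-d) * |z - x| ^ (-d))) ≠ ⊤)
    (hM : M3 (fun x y z => ENNReal.ofReal (|x - y| ^ (-d) * |y - z| ^ (-d) * |z - x| ^ (-d)))) :
    c3 d = (J3 (volume.restrict (Ioc 0 1)) (fun x y z =>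
      ENNReal.ofReal (|x - y| ^ (-d) * |y - z| ^ (-d) * |z - x| ^ (-d)))).toReal := by
  unfold c3
  simp only [intervalIntegral.integral_of_le zero_le_one]
  set μ : Measure ℝ := volume.restrict (Ioc 0 1)
  have r1 : ∀ x y, ∫ z, |x - y| ^ (-d) * |y - z| ^ (-d) * |z - x| ^ (-d) ∂μ =
      (∫⁻ z, ENNReal.ofReal (|x - y| ^ (-d) * |y - z| ^ (-d) * |z - x| ^ (-d)) ∂μ).toReal := by
    intro x y
    apply integral_eq_lintegral_of_nonneg_ae
    · exact Filter.Eventually.of_forall fun z => by positivity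
    · exact Measurable.aestronglyMeasurable (by fun_prop)
  simp only [r1]
  unfold J3 at hfin ⊢
  have f1 := ae_lt_top (hM.inner2 μ) hfin
  rw [← integral_toReal (hM.inner2 μ).aemeasurable f1]
  refine integral_congr_ae ?_
  filter_upwards [f1] with x hx
  have mx := (hM.inner μ).comp (measurable_prodMk_left (x := x))
  exact integral_toReal mx.aemeasurable (ae_lt_top mx hx.ne)

theorem rosenblatt_third_cumulant (d : ℝ) (h0 : 0 ≤ d) (h1 : d < 1/2) :
    c3 d = 6 * (Gamma (1-d) ^ 2 * Gamma (2-3*d) / (Gamma (2-2*d) * Gamma (4-3*d))) ∧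
    2 ^ 2 * (Nat.factorial 2 : ℝ) * ((1/2) * (1 - 2*d) * (1 - d)) ^ ((3:ℝ)/2) * c3 d =
      48 * ((1/2) * (1 - 2*d) * (1 - d)) ^ ((3:ℝ)/2) * (Gamma (1-d) ^ 2 * Gamma (2-3*d) / (Gamma (2-2*d) * Gamma (4-3*d))) := by
  have main : c3 d = 6 * (Gamma (1-d) ^ 2 * Gamma (2-3*d) / (Gamma (2-2*d) * Gamma (4-3*d))) := by
    have hM : M3 (fun x y z => ENNReal.ofReal (|x - y| ^ (-d) * |y - z| ^ (-d) * |z - x| ^ (-d))) := by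
      unfold M3
      fun_prop
    have hJ := J3_symm (volume.restrict (Ioc 0 1)) hM
      (fun x y z => by
        rw [abs_sub_comm y x, abs_sub_comm x z, abs_sub_comm z y]; congr 1; ring)
      (fun x y z => by
        rw [abs_sub_comm x z, abs_sub_comm z y, abs_sub_comm y x]; congr 1; ring)
    rw [J3_val h0 h1] at hJ
    rw [c3_eq_toReal d (by rw [hJ]; exact ENNReal.mul_ne_top (by norm_num) ENNReal.ofReal_ne_top) hM,
      hJ, ENNReal.toReal_mul, ENNReal.toReal_ofReal]
    · have g1 : Gamma (4 - 3*d) = (3 - 3*d) * ((2 - 3*d) * Gamma (2 - 3*d)) := by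
        rw [show 4 - 3*d = (3 - 3*d) + 1 by ring, Real.Gamma_add_one (by linarith),
          show 3 - 3*d = (2 - 3*d) + 1 by ring, Real.Gamma_add_one (by linarith)]
      have g2 : Gamma (2 - 3*d) ≠ 0 := (Real.Gamma_pos_of_pos (by linarith)).ne'
      have g3 : Gamma (2 - 2*d) ≠ 0 := (Real.Gamma_pos_of_pos (by linarith)).ne'
      have g4 : 3 - 3*d ≠ 0 := by linarith
      have g5 : 2 - 3*d ≠ 0 := by linarith
      rw [g1, ProbabilityTheory.beta, show 1 - d + (1 - d) = 2 - 2*d by ring]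
      simp only [ENNReal.toReal_ofNat]
      generalize Gamma (2 - 3*d) = A at *
      generalize Gamma (2 - 2*d) = B at *
      generalize 3 - 3*d = u at *
      generalize 2 - 3*d = v at *
      field_simp
    · exact div_nonneg (ProbabilityTheory.beta_pos (by linarith) (by linarith)).le
        (mul_nonneg (by linarith) (by linarith))
  refine ⟨main, ?_⟩
  rw [main]
  simp only [Nat.factorial]
  push_cast
  ring
end

section
/- Let d be a real number with 0 < d < 1/2. Then the fifth cumulant of the Rosenblatt distribution, κ₅(d) = 384·((1/2)(1−2d)(1−d))^(5/2)·c₅(d) where c₅(d) is the integral over [0,1]⁵ of |x₁−x₂|^(−d)|x₂−x₃|^(−d)|x₃−x₄|^(−d)|x₄−x₅|^(−d)|x₅−x₁|^(−d), satisfies κ₅(d) = 3840·((1/2)(1−2d)(1−d))^(5/2)·(Γ(4−5d)/Γ(6−5d))·S, where S = Γ(1−d)⁴/Γ(4−4d) + (Γ(1−d)³/((1−d)Γ(2−2d)))·(Γ(3−3d)/Γ(4−4d))·₃F₂(d, 1−d, 3−3d; 2−d, 4−4d; 1) + (Γ(1−d)²Γ(2−2d)/((1−d)Γ(4−4d)))·₃F₂(d,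 1−d, 2−2d; 2−d, 4−4d; 1) + (Γ(1−d)²/(3(1−d)Γ(3−2d)))·₃F₂(1, d, 3−3d; 3−2d, 4−3d; 1) + (2Γ(1−d)²/(3(1−d)²Γ(2−2d)))·₃F₂(1, d, 3−3d; 2−d, 4−3d; 1) + (Γ(1−d)²/((1−d)Γ(3−2d)))·₃F₂(1, d, 2−2d; 2−d, 3−2d; 1). -/
open Real

noncomputable def c5 (d : ℝ) : ℝ :=
  ∫ x1 in (0:ℝ)..1, ∫ x2 in (0:ℝ)..1, ∫ x3 in (0:ℝ)..1, ∫ x4 in (0:ℝ)..1, ∫ x5 in (0:ℝ)..1,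
    |x1 - x2| ^ (-d) * |x2 - x3| ^ (-d) * |x3 - x4| ^ (-d) * |x4 - x5| ^ (-d) * |x5 - x1| ^ (-d)

open MeasureTheory Set
open scoped ENNReal

/-- positive-part power kernel -/
noncomputable def qq (s u : ℝ) : ℝ≥0∞ := if 0 < u then ENNReal.ofReal (u ^ s) else 0

@[fun_prop]
lemma measurable_qq0 (s : ℝ) : Measurable (qq s) := by
  unfold qq
  exact Measurable.ite measurableSet_Ioi (by fun_prop) (by fun_prop)

@[fun_prop]
lemma measurable_qq {α : Type*} [MeasurableSpace α] (s : ℝ) {f : α → ℝ} (hf : Measurable f) :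
    Measurable (fun x => qq s (f x)) := (measurable_qq0 s).comp hf

lemma qq_pos {s u : ℝ} (h : 0 < u) : qq s u = ENNReal.ofReal (u ^ s) := if_pos h
lemma qq_neg {s u : ℝ} (h : u ≤ 0) : qq s u = 0 := if_neg h.not_gt

lemma qq_mul (s t u : ℝ) : qq s u * qq t u = qq (s+t) u := by
  by_cases h : 0 < u
  · rw [qq_pos h, qq_pos h, qq_pos h, Real.rpow_add h, ENNReal.ofReal_mul (by positivity)]
  · rw [qq_neg (not_lt.1 h), qq_neg (not_lt.1 h), zero_mul, qq_neg (not_lt.1 h)]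

lemma qq_scale {r : ℝ} (hr : 0 < r) (s u : ℝ) : qq s (r * u) = ENNReal.ofReal (r ^ s) * qq s u := by
  by_cases h : 0 < u
  · rw [qq_pos h, qq_pos (by positivity), Real.mul_rpow hr.le h.le,
      ENNReal.ofReal_mul (by positivity)]
  · rw [qq_neg (not_lt.1 h), qq_neg (by nlinarith), mul_zero]

lemma qq_ne_top (s u : ℝ) : qq s u ≠ ∞ := by
  unfold qq; split_ifs <;> simp

lemma lint_affine (F : ℝ → ℝ≥0∞) (hF : Measurable F) (a : ℝ) {r : ℝ} (hr : 0 < r) :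
    ∫⁻ x, F x = ENNReal.ofReal r * ∫⁻ t, F (a + r * t) := by
  have h1 : ∫⁻ x, F x = ∫⁻ x, F (a + x) := (lintegral_add_left_eq_self F a).symm
  have h2 := Real.map_volume_mul_left hr.ne'
  have h3 : ∫⁻ t, F (a + r * t) = ∫⁻ y, F (a + y) ∂(Measure.map (fun t => r * t) volume) := by
    rw [lintegral_map (by fun_prop) (by fun_prop)]
  rw [h3, h2, lintegral_smul_measure, h1, abs_of_pos (inv_pos.2 hr), smul_eq_mul, ← mul_assoc,
    ← ENNReal.ofReal_mul hr.le, mul_inv_cancel₀ hr.ne', ENNReal.ofReal_one, one_mul]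

lemma beta_lint {α β : ℝ} (hα : 0 < α) (hβ : 0 < β) :
    ∫⁻ t, qq (α-1) t * qq (β-1) (1-t) = ENNReal.ofReal (ProbabilityTheory.beta α β) := by
  have h := ProbabilityTheory.lintegral_betaPDF_eq_one hα hβ
  have hb := ProbabilityTheory.beta_pos hα hβ
  have : ∀ t, qq (α-1) t * qq (β-1) (1-t) =
      ENNReal.ofReal (ProbabilityTheory.beta α β) * ProbabilityTheory.betaPDF α β t := by
    intro t
    by_cases h0 : 0 < t
    · by_cases h1 : t < 1
      · rw [ProbabilityTheory.betaPDF_of_pos_lt_one h0 h1, qq_pos h0, qq_pos (by linarith),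
          ← ENNReal.ofReal_mul (by positivity), ← ENNReal.ofReal_mul (by positivity)]
        congr 1
        field_simp
      · rw [ProbabilityTheory.betaPDF_eq_zero_of_one_le (not_lt.1 h1),
          qq_neg (u := 1 - t) (by linarith)]; simp
    · rw [ProbabilityTheory.betaPDF_eq_zero_of_nonpos (not_lt.1 h0), qq_neg (not_lt.1 h0)]; simp
  simp_rw [this]
  rw [lintegral_const_mul' _ _ (by simp), h, mul_one]

lemma conv_lint {α β : ℝ} (hα : 0 < α) (hβ : 0 < β) (a b : ℝ) :
    ∫⁻ x, qq (α-1) (x-a) * qq (β-1) (b-x) =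
      ENNReal.ofReal (ProbabilityTheory.beta α β) * qq (α+β-1) (b-a) := by
  by_cases h : a < b
  · have hr : 0 < b - a := by linarith
    rw [lint_affine _ (by fun_prop) a hr]
    have : ∀ t, qq (α-1) (a + (b-a)*t - a) * qq (β-1) (b-(a + (b-a)*t)) =
        ENNReal.ofReal ((b-a)^(α+β-1-1)) * (qq (α-1) t * qq (β-1) (1-t)) := by
      intro t
      rw [show a + (b-a)*t - a = (b-a)*t by ring, show b-(a + (b-a)*t) = (b-a)*(1-t) by ring,
        qq_scale hr, qq_scale hr, show α+β-1-1 = (α-1)+(β-1) by ring, Real.rpow_add hr,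
        ENNReal.ofReal_mul (by positivity)]
      ring
    simp_rw [this]
    rw [lintegral_const_mul' _ _ (by simp), beta_lint hα hβ, qq_pos hr, ← mul_assoc,
      ← ENNReal.ofReal_mul hr.le, mul_comm]
    congr 3
    rw [Real.rpow_sub_one hr.ne']; field_simp
  · rw [qq_neg (u := b - a) (by linarith), mul_zero]
    rw [lintegral_eq_zero_iff (by fun_prop)]
    refine Filter.Eventually.of_forall fun x => ?_
    by_cases h1 : a < x
    · simp [qq_neg (u := b - x) (by linarith)]
    · simp [qq_neg (u := x - a) (by linarith)]

lemma poch_zero (a : ℝ) : poch a 0 = 1 := by simp [poch]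
lemma poch_succ (a : ℝ) (k : ℕ) : poch a (k+1) = poch a k * (a + k) := by
  simp [poch, Finset.prod_range_succ]
lemma poch_pos {a : ℝ} (ha : 0 < a) (k : ℕ) : 0 < poch a k := by
  unfold poch; exact Finset.prod_pos fun i _ => by positivity
lemma poch_one (k : ℕ) : poch 1 k = k.factorial := by
  induction k with
  | zero => simp [poch]
  | succ n ih => rw [poch_succ, ih, Nat.factorial_succ]; push_cast; ring
lemma poch_shift (a : ℝ) (k : ℕ) : poch (a+1) k * a = poch a k * (a + k) := by
  induction k with
  | zero => simp [poch]
  | succ n ih => rw [poch_succ, poch_succ]; push_cast; linear_combination (a+1+n) * ih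
lemma Gamma_poch {a : ℝ} (ha : 0 < a) (k : ℕ) : Real.Gamma (a + k) = Real.Gamma a * poch a k := by
  induction k with
  | zero => simp [poch]
  | succ n ih =>
    rw [poch_succ]; push_cast; rw [← add_assoc, Real.Gamma_add_one (by positivity), ih]; ring

lemma choose_poch (d : ℝ) (n : ℕ) : Ring.choose (d + n - 1) n = poch d n / n.factorial := by
  have h := Ring.factorial_nsmul_multichoose_eq_ascPochhammer d n
  rw [Polynomial.ascPochhammer_smeval_eq_eval] at h
  have h2 : ∀ m : ℕ, (ascPochhammer ℝ m).eval d = poch d m := by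
    intro m
    induction m with
    | zero => simp [poch]
    | succ m ih => rw [ascPochhammer_succ_eval, ih, poch_succ]
  rw [h2, nsmul_eq_mul] at h
  rw [← Ring.multichoose_eq, ← h]
  field_simp

lemma binom_series (d : ℝ) (hd : 0 < d) {u : ℝ} (h0 : 0 < u) (h1 : u < 1) :
    qq (-d) (1-u) = ∑' k : ℕ, ENNReal.ofReal (poch d k / k.factorial) * qq k u := by
  have h := (Real.one_div_one_sub_rpow_hasFPowerSeriesOnBall_zero d).hasSum (y := u)
    (by simpa [Real.enorm_eq_ofReal h0.le] using h1)
  simp only [zero_add, FormalMultilinearSeries.ofScalars_apply_eq, choose_poch] at h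
  have h3 : ∀ k : ℕ, ENNReal.ofReal (poch d k / k.factorial) * qq k u =
     ENNReal.ofReal ((poch d k / k.factorial) • u ^ k) := by
    intro k
    rw [qq_pos h0, ← ENNReal.ofReal_mul (by have := poch_pos hd k; positivity), Real.rpow_natCast,
      smul_eq_mul]
  simp_rw [h3]
  rw [← ENNReal.ofReal_tsum_of_nonneg _ h.summable, h.tsum_eq, qq_pos (by linarith),
    Real.rpow_neg (by linarith), one_div]
  intro k; have := poch_pos hd k; positivity

lemma beta_one_right {x : ℝ} (hx : 0 < x) : ProbabilityTheory.beta x 1 = 1 / x := by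
  have := Real.Gamma_pos_of_pos hx
  rw [ProbabilityTheory.beta, Real.Gamma_one, Real.Gamma_add_one hx.ne']; field_simp

lemma beta_nat_left {b : ℝ} (hb : 0 < b) (k : ℕ) :
    ProbabilityTheory.beta (k+1) b = k.factorial / (b * poch (b+1) k) := by
  have := Real.Gamma_pos_of_pos hb
  have := poch_pos (a := b+1) (by linarith) k
  rw [ProbabilityTheory.beta, Real.Gamma_nat_eq_factorial, show (k:ℝ)+1+b = (b+1)+k by ring,
    Gamma_poch (by linarith), Real.Gamma_add_one hb.ne']; field_simp

noncomputable def t32 (a b c e f : ℝ) (k : ℕ) : ℝ :=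
  poch a k * poch b k * poch c k / (poch e k * poch f k * (Nat.factorial k : ℝ))

noncomputable def E32 (a b c e f : ℝ) : ℝ≥0∞ := ∑' k, ENNReal.ofReal (t32 a b c e f k)

lemma E32_toReal {a b c e f : ℝ} (ha : 0 < a) (hb : 0 < b) (hc : 0 < c) (he : 0 < e) (hf : 0 < f) :
    (E32 a b c e f).toReal = F32 a b c e f := by
  rw [E32, F32, ENNReal.tsum_toReal_eq (by simp)]
  congr 1; ext k
  have := poch_pos ha k; have := poch_pos hb k; have := poch_pos hc k
  have := poch_pos he k; have := poch_pos hf k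
  rw [ENNReal.toReal_ofReal (by unfold t32; positivity), t32]

noncomputable def Mint (d b s : ℝ) : ℝ≥0∞ :=
  ∫⁻ y, qq s y * qq 0 (1-y) * ∫⁻ z, qq 0 z * qq (-d) (1-z) * qq (b-1) (y-z)

noncomputable def Nint (d p q : ℝ) : ℝ≥0∞ :=
  ∫⁻ s, qq (p-1) s * qq (q-1) (1-s) * ∫⁻ u, qq (-d) u * qq (-d) (1-u) * qq 0 (s-u)

lemma binom_mul {d : ℝ} (hd : 0 < d) (s t c v : ℝ) (y z : ℝ) :
    qq s y * qq c (1-y) * (qq t z * qq (-d) (1-z) * qq v (y-z)) =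
    ∑' k : ℕ, ENNReal.ofReal (poch d k / k.factorial) *
      (qq s y * qq c (1-y) * (qq (t+k) z * qq v (y-z))) := by
  by_cases hz : 0 < z
  · by_cases hy : y < 1
    · by_cases hzy : z < y
      · rw [binom_series d hd hz (by linarith), ← ENNReal.tsum_mul_left, ← ENNReal.tsum_mul_right,
          ← ENNReal.tsum_mul_left]
        congr 1; ext k
        rw [← qq_mul t]; ring
      · simp [qq_neg (u := y - z) (by linarith)]
    · simp [qq_neg (u := 1 - y) (by linarith)]
  · simp [qq_neg (u := z) (by linarith)]

lemma gen_int {d : ℝ} (hd : 0 < d) {s t c v : ℝ} (ht : 0 < t) (hv : 0 < v) (hc : 0 < c)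
    (hs : 0 < s + t + v) :
    ∫⁻ y, qq s y * qq (c-1) (1-y) * ∫⁻ z, qq (t-1) z * qq (-d) (1-z) * qq (v-1) (y-z) =
    ∑' k : ℕ, ENNReal.ofReal (poch d k / k.factorial) *
      (ENNReal.ofReal (ProbabilityTheory.beta (k + t) v) *
       ENNReal.ofReal (ProbabilityTheory.beta (s+t+v+k) c)) := by
  have e1 : ∀ y, qq s y * qq (c-1) (1-y) * ∫⁻ z, qq (t-1) z * qq (-d) (1-z) * qq (v-1) (y-z) =
      ∑' k : ℕ, ENNReal.ofReal (poch d k / k.factorial) *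
        (ENNReal.ofReal (ProbabilityTheory.beta (k + t) v) *
          (qq (s+t+v+k-1) y * qq (c-1) (1-y))) := by
    intro y
    rw [← lintegral_const_mul _ (by fun_prop)]
    simp_rw [binom_mul hd]
    rw [lintegral_tsum (fun k => by fun_prop)]
    congr 1; ext k
    rw [lintegral_const_mul _ (by fun_prop), lintegral_const_mul _ (by fun_prop)]
    have := conv_lint (α := k + t) (β := v) (by positivity) hv 0 y
    rw [sub_zero] at this
    simp_rw [sub_zero] at this
    rw [show t - 1 + (k:ℝ) = k + t - 1 by ring, this,
      show s+t+v+k-1 = s + (k + t + v - 1) by ring, ← qq_mul s]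
    ring
  simp_rw [e1]
  rw [lintegral_tsum (fun k => by fun_prop)]
  congr 1; ext k
  rw [lintegral_const_mul _ (by fun_prop), lintegral_const_mul _ (by fun_prop),
    beta_lint (by positivity) hc]

lemma Mint_eq {d b s : ℝ} (hd : 0 < d) (hb : 0 < b) (hs : 0 < s + b + 1) :
    Mint d b s = ENNReal.ofReal (1 / (b * (s+b+1))) * E32 1 d (s+b+1) (b+1) (s+b+2) := by
  have := gen_int (d := d) (s := s) (t := 1) (c := 1) (v := b) hd one_pos hb one_pos (by linarith)
  rw [sub_self] at this
  rw [Mint, this, E32, ← ENNReal.tsum_mul_left]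
  congr 1; ext k
  have hk := poch_pos hd k
  have hk1 := poch_pos (a := b+1) (by linarith) k
  have hk2 := poch_pos hs k
  have hk3 := poch_pos (a := s+b+1+1) (by linarith) k
  have hsh := poch_shift (s+b+1) k
  have hkn : (0:ℝ) ≤ k := by positivity
  have hx : 0 < s + b + 1 + k := by linarith
  rw [show s+1+b+k = s+b+1+k by ring, beta_nat_left hb, beta_one_right hx, ← ENNReal.ofReal_mul (by positivity),
    ← ENNReal.ofReal_mul (by positivity), ← ENNReal.ofReal_mul (by positivity), t32, poch_one]
  congr 1
  rw [show s+b+2 = s+b+1+1 by ring]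
  field_simp
  linear_combination hsh

lemma Nint_eq {d p q : ℝ} (hd : 0 < d) (hd1 : d < 1) (hp : 0 < p) (hq : 0 < q) :
    Nint d p q = ENNReal.ofReal (Real.Gamma (p+1-d) * Real.Gamma q / ((1-d) * Real.Gamma (p+q+1-d)))
      * E32 d (1-d) (p+1-d) (2-d) (p+q+1-d) := by
  have := gen_int (d := d) (s := p-1) (t := 1-d) (c := q) (v := 1) hd (by linarith) one_pos hq
    (by linarith)
  rw [sub_self, show 1-d-1 = -d by ring] at this
  rw [Nint, this, E32, ← ENNReal.tsum_mul_left]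
  congr 1; ext k
  have hd2 : 0 < 1 - d := by linarith
  have hk := poch_pos hd k
  have hk1 := poch_pos hd2 k
  have hk2 := poch_pos (a := 1-d+1) (by linarith) k
  have hk3 := poch_pos (a := p+1-d) (by linarith) k
  have hk4 := poch_pos (a := p+q+1-d) (by linarith) k
  have hg := Real.Gamma_pos_of_pos (s := p+1-d) (by linarith)
  have hg2 := Real.Gamma_pos_of_pos (s := p+q+1-d) (by linarith)
  have hg3 := Real.Gamma_pos_of_pos hq
  have hsh := poch_shift (1-d) k
  rw [beta_one_right (by positivity), ProbabilityTheory.beta,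
    show p-1+(1-d)+1+k+q = p+q+1-d+k by ring, show p-1+(1-d)+1+k = p+1-d+k by ring,
    Gamma_poch (by linarith), Gamma_poch (by linarith),
    ← ENNReal.ofReal_mul (by positivity),
    ← ENNReal.ofReal_mul (by positivity), ← ENNReal.ofReal_mul (by positivity), t32]
  congr 1
  rw [show 2-d = 1-d+1 by ring]
  have : 0 < k + (1-d) := by positivity
  field_simp
  linear_combination hsh

noncomputable def KK (d x y : ℝ) : ℝ≥0∞ := qq (-d) (x-y) + qq (-d) (y-x)

@[fun_prop]
lemma measurable_KK {α : Type*} [MeasurableSpace α] (d : ℝ) {f g : α → ℝ} (hf : Measurable f)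
    (hg : Measurable g) : Measurable (fun x => KK d (f x) (g x)) := by
  unfold KK; fun_prop

noncomputable def bE (d : ℝ) : ℝ≥0∞ := ENNReal.ofReal (ProbabilityTheory.beta (1-d) (1-d))

lemma lint_refl (F : ℝ → ℝ≥0∞) : ∫⁻ x, F x = ∫⁻ x, F (1 - x) :=
  (lintegral_sub_left_eq_self F 1).symm

/-- left weight -/
noncomputable def wl (d u : ℝ) : ℝ≥0∞ := qq 0 u * qq (-d) (1-u)
/-- right weight -/
noncomputable def wr (d t : ℝ) : ℝ≥0∞ := qq (-d) t * qq 0 (1-t)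

@[fun_prop]
lemma measurable_wl {α : Type*} [MeasurableSpace α] (d : ℝ) {f : α → ℝ} (hf : Measurable f) :
    Measurable (fun x => wl d (f x)) := by unfold wl; fun_prop
@[fun_prop]
lemma measurable_wr {α : Type*} [MeasurableSpace α] (d : ℝ) {f : α → ℝ} (hf : Measurable f) :
    Measurable (fun x => wr d (f x)) := by unfold wr; fun_prop

noncomputable def gt (d v : ℝ) : ℝ≥0∞ := ∫⁻ u, wl d u * qq (-d) (v-u)
noncomputable def gr (d v : ℝ) : ℝ≥0∞ := ∫⁻ t, wr d t * qq (-d) (t-v)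

@[fun_prop]
lemma measurable_gt (d : ℝ) : Measurable (gt d) := by
  unfold gt; fun_prop
@[fun_prop]
lemma measurable_gr (d : ℝ) : Measurable (gr d) := by
  unfold gr; fun_prop

lemma gr_refl (d v : ℝ) : gr d v = gt d (1-v) := by
  rw [gr, gt, lint_refl]
  congr 1; ext t
  rw [wr, wl, show 1 - (1-t) = t by ring, show 1-t-v = 1-v-t by ring]; ring

lemma Pl_eq {d : ℝ} (hd1 : d < 1) {v : ℝ} (hv : 0 < v) :
    ∫⁻ u, wl d u * qq (-d) (u-v) = bE d * qq (1-2*d) (1-v) := by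
  have := conv_lint (α := 1-d) (β := 1-d) (by linarith) (by linarith) v 1
  rw [show 1-d+(1-d)-1 = 1-2*d by ring, show 1-d-1 = -d by ring] at this
  rw [bE, ← this]
  congr 1; ext u
  rw [wl]
  by_cases h : v < u
  · rw [qq_pos (s := 0) (by linarith), Real.rpow_zero, ENNReal.ofReal_one]; ring
  · simp [qq_neg (u := u - v) (by linarith)]

lemma Pr_eq {d : ℝ} (hd1 : d < 1) {v : ℝ} (hv : v < 1) :
    ∫⁻ t, wr d t * qq (-d) (v-t) = bE d * qq (1-2*d) v := by
  have := conv_lint (α := 1-d) (β := 1-d) (by linarith) (by linarith) 0 v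
  rw [show 1-d+(1-d)-1 = 1-2*d by ring, show 1-d-1 = -d by ring] at this
  simp_rw [sub_zero] at this
  rw [bE, ← this]
  congr 1; ext u
  rw [wr]
  by_cases h : u < v
  · rw [qq_pos (s := 0) (by linarith), Real.rpow_zero, ENNReal.ofReal_one]; ring
  · simp [qq_neg (u := v - u) (by linarith)]

noncomputable def DD (d : ℝ) : ℝ≥0∞ := ∫⁻ u, ∫⁻ t, wl d u * KK d u t * wr d t

lemma DD_eq {d : ℝ} (hd1 : d < 1) :
    DD d = bE d * ENNReal.ofReal (ProbabilityTheory.beta (2-2*d) (1-d)) + Mint d (1-d) (-d) := by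
  have e : ∀ u, ∫⁻ t, wl d u * KK d u t * wr d t =
      bE d * (qq (2-2*d-1) u * qq (1-d-1) (1-u)) + ∫⁻ t, wl d u * (wr d t * qq (-d) (t-u)) := by
    intro u
    have : ∀ t, wl d u * KK d u t * wr d t = wl d u * (wr d t * qq (-d) (u-t)) +
       wl d u * (wr d t * qq (-d) (t-u)) := by intro t; rw [KK]; ring
    simp_rw [this]
    rw [lintegral_add_left (by fun_prop), lintegral_const_mul _ (by fun_prop)]
    congr 1
    by_cases h : u < 1
    · rw [Pr_eq hd1 h, wl, show 2-2*d-1 = 0 + (1-2*d) by ring, ← qq_mul 0,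
        show 1-d-1 = -d by ring]; ring
    · rw [wl]; simp [qq_neg (u := 1 - u) (by linarith)]
  rw [DD]; simp_rw [e]
  rw [lintegral_add_left (by fun_prop), lintegral_const_mul _ (by fun_prop),
    beta_lint (by linarith) (by linarith)]
  congr 1
  rw [lintegral_lintegral_swap (by fun_prop), Mint]
  congr 1; ext t
  rw [show 1-d-1 = -d by ring, ← wr, ← lintegral_const_mul _ (by fun_prop)]
  congr 1; ext u
  rw [wl]; ring

noncomputable def AA (d : ℝ) : ℝ≥0∞ :=
  ∫⁻ u, ∫⁻ v, ∫⁻ t, wl d u * KK d u v * (qq 0 v * qq 0 (1-v)) * KK d v t * wr d t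

lemma AA_eq0 {d : ℝ} (hd1 : d < 1) :
    AA d = ∫⁻ v, qq 0 v * qq 0 (1-v) * ((bE d * qq (1-2*d) (1-v) + gt d v) *
      (bE d * qq (1-2*d) v + gr d v)) := by
  rw [AA, lintegral_lintegral_swap (by fun_prop)]
  congr 1; ext v
  have e1 : ∀ u, ∫⁻ t, wl d u * KK d u v * (qq 0 v * qq 0 (1-v)) * KK d v t * wr d t =
      (wl d u * KK d u v) * (qq 0 v * qq 0 (1-v) * ∫⁻ t, wr d t * KK d v t) := by
    intro u
    rw [← lintegral_const_mul _ (by fun_prop), ← lintegral_const_mul _ (by fun_prop)]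
    congr 1; ext t; ring
  simp_rw [e1]
  rw [lintegral_mul_const _ (by fun_prop)]
  by_cases h0 : 0 < v
  · by_cases h1 : v < 1
    · have e2 : ∫⁻ t, wr d t * KK d v t = bE d * qq (1-2*d) v + gr d v := by
        unfold KK
        simp_rw [mul_add]
        rw [lintegral_add_left (by fun_prop), Pr_eq hd1 h1, gr]
      have e3 : ∫⁻ t, wl d t * KK d t v = bE d * qq (1-2*d) (1-v) + gt d v := by
        unfold KK
        simp_rw [mul_add]
        rw [lintegral_add_left (by fun_prop), Pl_eq hd1 h0, gt]
      rw [e2, e3]; ring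
    · simp [qq_neg (u := 1 - v) (by linarith)]
  · simp [qq_neg (u := v) (by linarith)]

lemma A2_eq {d : ℝ} : ∫⁻ v, qq (1-2*d) v * qq 0 (1-v) * gt d v = Mint d (1-d) (1-2*d) := by
  rw [Mint, show 1-d-1 = -d by ring]; rfl

lemma A3_eq {d : ℝ} : ∫⁻ v, qq (1-2*d) (1-v) * qq 0 v * gr d v = Mint d (1-d) (1-2*d) := by
  rw [← A2_eq, lint_refl]
  congr 1; ext v; rw [gr_refl, show 1-(1-v) = v by ring]

lemma A4_eq {d : ℝ} (hd1 : d < 1) :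
    ∫⁻ v, qq 0 v * qq 0 (1-v) * (gt d v * gr d v) = bE d * Mint d (2-2*d) (-d) := by
  have e1 : ∀ v, qq 0 v * qq 0 (1-v) * (gt d v * gr d v) =
      ∫⁻ t, ∫⁻ u, wr d t * wl d u * (qq (-d) (v-u) * qq (-d) (t-v)) := by
    intro v
    have : ∀ t, ∫⁻ u, wr d t * wl d u * (qq (-d) (v-u) * qq (-d) (t-v)) =
       gt d v * (wr d t * qq (-d) (t-v)) := by
      intro t
      rw [gt, ← lintegral_mul_const _ (by fun_prop)]
      congr 1; ext u; ring
    simp_rw [this]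
    rw [lintegral_const_mul _ (by fun_prop), ← gr]
    by_cases h0 : 0 < v
    · by_cases h1 : v < 1
      · simp [qq_pos h0, qq_pos (u := 1-v) (by linarith)]
      · have : gr d v = 0 := by
          rw [gr, lintegral_eq_zero_iff (by fun_prop)]
          refine Filter.Eventually.of_forall fun t => ?_
          by_cases ht : t < 1
          · simp [qq_neg (u := t - v) (by linarith)]
          · simp [wr, qq_neg (u := 1 - t) (by linarith)]
        simp [this]
    · have : gt d v = 0 := by
        rw [gt, lintegral_eq_zero_iff (by fun_prop)]
        refine Filter.Eventually.of_forall fun t => ?_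
        by_cases ht : 0 < t
        · simp [qq_neg (u := v - t) (by linarith)]
        · simp [wl, qq_neg (u := t) (by linarith)]
      simp [this]
  simp_rw [e1]
  rw [lintegral_lintegral_swap (by fun_prop), Mint, ← lintegral_const_mul _ (by fun_prop)]
  congr 1; ext t
  rw [lintegral_lintegral_swap (by fun_prop), ← lintegral_const_mul _ (by fun_prop),
    ← lintegral_const_mul _ (by fun_prop)]
  congr 1; ext u
  rw [lintegral_const_mul _ (by fun_prop)]
  have := conv_lint (α := 1-d) (β := 1-d) (by linarith) (by linarith) u t
  rw [show 1-d+(1-d)-1 = 2-2*d-1 by ring, show 1-d-1 = -d by ring] at this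
  rw [this, wr, wl, bE]; ring

lemma AA_eq {d : ℝ} (hd1 : d < 1) :
    AA d = bE d * bE d * ENNReal.ofReal (ProbabilityTheory.beta (2-2*d) (2-2*d))
      + 2 * (bE d * Mint d (1-d) (1-2*d)) + bE d * Mint d (2-2*d) (-d) := by
  rw [AA_eq0 hd1]
  have e : ∀ v, qq 0 v * qq 0 (1-v) * ((bE d * qq (1-2*d) (1-v) + gt d v) *
      (bE d * qq (1-2*d) v + gr d v)) =
      bE d * bE d * (qq (2-2*d-1) v * qq (2-2*d-1) (1-v)) +
      bE d * (qq (1-2*d) v * qq 0 (1-v) * gt d v) +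
      bE d * (qq (1-2*d) (1-v) * qq 0 v * gr d v) +
      qq 0 v * qq 0 (1-v) * (gt d v * gr d v) := by
    intro v
    have h1 : qq (1-2*d) v = qq 0 v * qq (1-2*d) v := by rw [qq_mul, zero_add]
    have h2 : qq (1-2*d) (1-v) = qq 0 (1-v) * qq (1-2*d) (1-v) := by rw [qq_mul, zero_add]
    rw [show 2-2*d-1 = 1-2*d by ring]
    calc
      _ = bE d * bE d * ((qq 0 v * qq (1-2*d) v) * (qq 0 (1-v) * qq (1-2*d) (1-v))) +
      bE d * ((qq 0 v * qq (1-2*d) v) * qq 0 (1-v) * gt d v) +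
      bE d * ((qq 0 (1-v) * qq (1-2*d) (1-v)) * qq 0 v * gr d v) +
      qq 0 v * qq 0 (1-v) * (gt d v * gr d v) := by ring
      _ = _ := by rw [← h1, ← h2]
  simp_rw [e]
  rw [lintegral_add_left (by fun_prop), lintegral_add_left (by fun_prop),
    lintegral_add_left (by fun_prop), lintegral_const_mul _ (by fun_prop),
    lintegral_const_mul _ (by fun_prop), lintegral_const_mul _ (by fun_prop),
    A2_eq, A3_eq, A4_eq hd1, beta_lint (by linarith) (by linarith)]
  ring

lemma N_sum {d : ℝ} (hd1 : d < 1) :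
    Nint d (2-2*d) (1-d) + Nint d (1-d) (2-2*d) =
      bE d * ENNReal.ofReal (ProbabilityTheory.beta (2-2*d) (1-d)) := by
  have h2 : Nint d (1-d) (2-2*d) = ∫⁻ s, qq (2-2*d-1) s * qq (1-d-1) (1-s) *
      ∫⁻ u, qq (-d) u * qq (-d) (1-u) * qq 0 (u-s) := by
    rw [Nint, lint_refl]
    congr 1; ext s
    rw [lint_refl (fun u => qq (-d) u * qq (-d) (1-u) * qq 0 (1-s-u)), show 1-(1-s) = s by ring,
      mul_comm (qq (1-d-1) _)]
    congr 2; ext u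
    rw [show 1-(1-u) = u by ring, show 1-s-(1-u) = u-s by ring]; ring
  rw [h2, Nint, ← lintegral_add_left (by fun_prop)]
  rw [← beta_lint (by linarith) (by linarith), ← lintegral_const_mul _ (by fun_prop)]
  congr 1; ext s
  rw [← mul_add, ← lintegral_add_left (by fun_prop), mul_comm (bE d)]
  congr 1
  rw [bE, ← beta_lint (by linarith) (by linarith), show 1-d-1 = -d by ring]
  apply lintegral_congr_ae
  have : ∀ᵐ u : ℝ, u ≠ s := by simp [ae_iff]
  filter_upwards [this] with u hu
  rw [← mul_add]
  rcases lt_or_gt_of_ne hu with h | h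
  · rw [qq_pos (s := 0) (u := s - u) (by linarith), qq_neg (s := 0) (u := u - s) (by linarith)]; simp
  · rw [qq_pos (s := 0) (u := u - s) (by linarith), qq_neg (s := 0) (u := s - u) (by linarith)]; simp

/-- indicator weight of the unit interval -/
noncomputable def ww (x : ℝ) : ℝ≥0∞ := qq 0 x * qq 0 (1-x)

@[fun_prop]
lemma measurable_ww {α : Type*} [MeasurableSpace α] {f : α → ℝ} (hf : Measurable f) :
    Measurable (fun x => ww (f x)) := by unfold ww; fun_prop

lemma ww_eq (x : ℝ) : ww x = (Ioo (0:ℝ) 1).indicator 1 x := by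
  by_cases h : x ∈ Ioo (0:ℝ) 1
  · rw [indicator_of_mem h, ww, qq_pos h.1, qq_pos (by linarith [h.2])]; simp
  · rw [indicator_of_notMem h, ww]
    by_cases h0 : 0 < x
    · have : ¬ x < 1 := fun h1 => h ⟨h0, h1⟩
      simp [qq_neg (u := 1 - x) (by linarith)]
    · simp [qq_neg (u := x) (by linarith)]

lemma ww_lint (F : ℝ → ℝ≥0∞) : ∫⁻ x in Ioc (0:ℝ) 1, F x = ∫⁻ x, ww x * F x := by
  rw [setLIntegral_congr Ioo_ae_eq_Ioc.symm, ← lintegral_indicator measurableSet_Ioo]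
  congr 1; ext x
  rw [ww_eq]
  by_cases h : x ∈ Ioo (0:ℝ) 1 <;> simp [h]

lemma int_step (F : ℝ → ℝ≥0∞) (hF : Measurable F) (hf : ∀ x, F x ≠ ∞) :
    ∫ x in (0:ℝ)..1, (F x).toReal = (∫⁻ x, ww x * F x).toReal := by
  rw [intervalIntegral.integral_of_le zero_le_one, integral_toReal hF.aemeasurable
    (Filter.Eventually.of_forall fun x => (hf x).lt_top), ww_lint]

lemma KK_eq {d : ℝ} (hd : 0 < d) (x y : ℝ) : KK d x y = ENNReal.ofReal (|x-y| ^ (-d)) := by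
  rcases lt_trichotomy x y with h | h | h
  · rw [KK, qq_neg (by linarith), qq_pos (by linarith), abs_of_neg (by linarith)]; simp
  · subst h
    rw [KK, sub_self, qq_neg le_rfl, abs_zero, Real.zero_rpow (by linarith)]; simp
  · rw [KK, qq_pos (by linarith), qq_neg (by linarith), abs_of_pos (by linarith)]; simp

lemma KK_ne_top (d x y : ℝ) : KK d x y ≠ ∞ := by
  simp [KK, qq_ne_top]

lemma KK_comm (d x y : ℝ) : KK d x y = KK d y x := by rw [KK, KK, add_comm]

lemma KK_sq (d x y : ℝ) : KK d x y * KK d x y = KK (2*d) x y := by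
  rw [KK, KK, show -(2*d) = -d + -d by ring, ← qq_mul, ← qq_mul]
  by_cases h : x < y
  · simp [qq_neg (u := x - y) (by linarith)]
  · simp [qq_neg (u := y - x) (by linarith)]

lemma ennreal_mul_le (a b : ℝ≥0∞) : a * b ≤ a * a + b * b := by
  rcases le_total a b with h | h
  · exact (mul_le_mul_left h b).trans le_add_self
  · exact (mul_le_mul_right h a).trans le_self_add

lemma lint_ww : ∫⁻ x, ww x = 1 := by
  have := ww_lint (fun _ => 1)
  simp at this; exact this.symm

lemma qq_bound {e : ℝ} (he : 0 ≤ e) (x u : ℝ) :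
    ww x * qq (-e) u ≤ ww x + qq (-e) u * qq 0 (1-u) := by
  have hw : ww x ≤ 1 := by
    rw [ww_eq]; exact indicator_le_self' (fun _ _ => zero_le) x
  by_cases h1 : u < 1
  · rw [qq_pos (u := 1 - u) (by linarith), Real.rpow_zero, ENNReal.ofReal_one, mul_one]
    calc _ ≤ 1 * qq (-e) u := by gcongr
      _ ≤ _ := by rw [one_mul]; exact le_add_self
  · have : qq (-e) u ≤ 1 := by
      rw [qq_pos (by linarith), ← ENNReal.ofReal_one]
      exact ENNReal.ofReal_le_ofReal (Real.rpow_le_one_of_one_le_of_nonpos (by linarith)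
        (by linarith))
    calc _ ≤ ww x * 1 := by gcongr
      _ ≤ _ := by rw [mul_one]; exact le_self_add

lemma K_bound {e : ℝ} (he : 0 ≤ e) (he1 : e < 1) :
    ∃ C : ℝ≥0∞, C ≠ ∞ ∧ ∀ a, ∫⁻ x, ww x * KK e a x ≤ C := by
  have hb : ∫⁻ t, qq (-e) t * qq 0 (1-t) = ENNReal.ofReal (ProbabilityTheory.beta (1-e) 1) := by
    have := beta_lint (α := 1-e) (β := 1) (by linarith) one_pos
    rwa [sub_self, show 1-e-1 = -e by ring] at this
  refine ⟨(1 + ENNReal.ofReal (ProbabilityTheory.beta (1-e) 1)) +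
    (1 + ENNReal.ofReal (ProbabilityTheory.beta (1-e) 1)), by simp, fun a => ?_⟩
  unfold KK
  simp_rw [mul_add]
  rw [lintegral_add_left (by fun_prop)]
  gcongr
  · calc _ ≤ ∫⁻ x, ww x + qq (-e) (a-x) * qq 0 (1-(a-x)) := lintegral_mono fun x => qq_bound he _ _
      _ = _ := by
        rw [lintegral_add_left (by fun_prop), lint_ww,
          lintegral_sub_left_eq_self (fun t => qq (-e) t * qq 0 (1-t)), hb]
  · calc _ ≤ ∫⁻ x, ww x + qq (-e) (x-a) * qq 0 (1-(x-a)) := lintegral_mono fun x => qq_bound he _ _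
      _ = _ := by
        rw [lintegral_add_left (by fun_prop), lint_ww,
          lintegral_sub_right_eq_self (fun t => qq (-e) t * qq 0 (1-t)), hb]

lemma K2_bound {d : ℝ} (hd : 0 < d) (hd1 : d < 1/2) :
    ∃ C : ℝ≥0∞, C ≠ ∞ ∧ ∀ a b, ∫⁻ x, ww x * (KK d a x * KK d x b) ≤ C := by
  obtain ⟨C, hC, h⟩ := K_bound (e := 2*d) (by linarith) (by linarith)
  refine ⟨C + C, by simp [hC], fun a b => ?_⟩
  calc _ ≤ ∫⁻ x, ww x * KK (2*d) a x + ww x * KK (2*d) b x := by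
        apply lintegral_mono; intro x
        show ww x * (KK d a x * KK d x b) ≤ ww x * KK (2*d) a x + ww x * KK (2*d) b x
        rw [← mul_add, ← KK_sq, ← KK_sq, KK_comm d x b]
        gcongr; exact ennreal_mul_le _ _
    _ ≤ _ := by
      rw [lintegral_add_left (by fun_prop)]; exact add_le_add (h a) (h b)

noncomputable def f5 (d x1 x2 x3 x4 x5 : ℝ) : ℝ≥0∞ :=
  KK d x1 x2 * KK d x2 x3 * KK d x3 x4 * KK d x4 x5 * KK d x5 x1

noncomputable def I5 (d : ℝ) : ℝ≥0∞ :=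
  ∫⁻ x1, ww x1 * ∫⁻ x2, ww x2 * ∫⁻ x3, ww x3 * ∫⁻ x4, ww x4 * ∫⁻ x5, ww x5 * f5 d x1 x2 x3 x4 x5

lemma ofReal_f5 {d : ℝ} (hd : 0 < d) (x1 x2 x3 x4 x5 : ℝ) :
    |x1 - x2| ^ (-d) * |x2 - x3| ^ (-d) * |x3 - x4| ^ (-d) * |x4 - x5| ^ (-d) * |x5 - x1| ^ (-d)
     = (f5 d x1 x2 x3 x4 x5).toReal := by
  rw [f5]; simp_rw [KK_eq hd, ENNReal.toReal_mul]
  repeat rw [ENNReal.toReal_ofReal (by positivity)]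

lemma c5_eq {d : ℝ} (hd : 0 < d) (hd1 : d < 1/2) : c5 d = (I5 d).toReal ∧ I5 d ≠ ∞ := by
  obtain ⟨C, hC, hC'⟩ := K2_bound hd hd1
  obtain ⟨B, hB, hB'⟩ := K_bound (e := d) hd.le (by linarith)
  have b5 : ∀ x1 x2 x3 x4, ∫⁻ x5, ww x5 * f5 d x1 x2 x3 x4 x5 ≤
      KK d x1 x2 * KK d x2 x3 * KK d x3 x4 * C := by
    intro x1 x2 x3 x4
    have : ∀ x5, ww x5 * f5 d x1 x2 x3 x4 x5 = (KK d x1 x2 * KK d x2 x3 * KK d x3 x4) *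
       (ww x5 * (KK d x4 x5 * KK d x5 x1)) := by intro x5; rw [f5]; ring
    simp_rw [this]
    rw [lintegral_const_mul _ (by fun_prop)]
    gcongr; exact hC' _ _
  have key : ∀ (G : ℝ → ℝ≥0∞) (P D : ℝ≥0∞) (a : ℝ), (∀ x, G x ≤ P * KK d a x * D) →
      ∫⁻ x, ww x * G x ≤ P * (B * D) := by
    intro G P D a h
    calc _ ≤ ∫⁻ x, P * D * (ww x * KK d a x) := by
          apply lintegral_mono; intro x
          calc ww x * G x ≤ ww x * (P * KK d a x * D) := by gcongr; exact h x
            _ = _ := by ring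
      _ = P * D * ∫⁻ x, ww x * KK d a x := lintegral_const_mul _ (by fun_prop)
      _ ≤ P * D * B := by gcongr; exact hB' a
      _ = _ := by ring
  have b4 : ∀ x1 x2 x3, ∫⁻ x4, ww x4 * ∫⁻ x5, ww x5 * f5 d x1 x2 x3 x4 x5 ≤
      KK d x1 x2 * KK d x2 x3 * (B * C) := fun x1 x2 x3 => key _ _ _ x3 (b5 x1 x2 x3)
  have b3 : ∀ x1 x2, ∫⁻ x3, ww x3 * ∫⁻ x4, ww x4 * ∫⁻ x5, ww x5 * f5 d x1 x2 x3 x4 x5 ≤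
      KK d x1 x2 * (B * (B * C)) := fun x1 x2 => key _ _ _ x2 (b4 x1 x2)
  have b2 : ∀ x1, ∫⁻ x2, ww x2 * ∫⁻ x3, ww x3 * ∫⁻ x4, ww x4 * ∫⁻ x5, ww x5 * f5 d x1 x2 x3 x4 x5 ≤
      1 * (B * (B * (B * C))) := fun x1 => key _ _ _ x1 (fun x2 => by rw [one_mul]; exact b3 x1 x2)
  have n5 : ∀ x1 x2 x3 x4, ∫⁻ x5, ww x5 * f5 d x1 x2 x3 x4 x5 ≠ ∞ := fun x1 x2 x3 x4 =>
    ne_top_of_le_ne_top (by finiteness [KK_ne_top d x1 x2, KK_ne_top d x2 x3, KK_ne_top d x3 x4]) (b5 x1 x2 x3 x4)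
  have n4 : ∀ x1 x2 x3, ∫⁻ x4, ww x4 * ∫⁻ x5, ww x5 * f5 d x1 x2 x3 x4 x5 ≠ ∞ := fun x1 x2 x3 =>
    ne_top_of_le_ne_top (by finiteness [KK_ne_top d x1 x2, KK_ne_top d x2 x3]) (b4 x1 x2 x3)
  have n3 : ∀ x1 x2, ∫⁻ x3, ww x3 * ∫⁻ x4, ww x4 * ∫⁻ x5, ww x5 * f5 d x1 x2 x3 x4 x5 ≠ ∞ :=
    fun x1 x2 => ne_top_of_le_ne_top (by finiteness [KK_ne_top d x1 x2]) (b3 x1 x2)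
  have n2 : ∀ x1, ∫⁻ x2, ww x2 * ∫⁻ x3, ww x3 * ∫⁻ x4, ww x4 * ∫⁻ x5, ww x5 * f5 d x1 x2 x3 x4 x5
      ≠ ∞ := fun x1 => ne_top_of_le_ne_top (by finiteness) (b2 x1)
  constructor
  · rw [c5, I5, ← int_step _ (by unfold f5; fun_prop) n2]
    congr 1; ext x1
    rw [← int_step _ (by unfold f5; fun_prop) (n3 x1)]
    congr 1; ext x2
    rw [← int_step _ (by unfold f5; fun_prop) (n4 x1 x2)]
    congr 1; ext x3
    rw [← int_step _ (by unfold f5; fun_prop) (n5 x1 x2 x3)]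
    congr 1; ext x4
    rw [← int_step _ (by unfold f5; fun_prop) (fun x5 => by
      unfold f5
      finiteness [KK_ne_top d x1 x2, KK_ne_top d x2 x3, KK_ne_top d x3 x4, KK_ne_top d x4 x5,
        KK_ne_top d x5 x1])]
    congr 1; ext x5
    exact ofReal_f5 hd x1 x2 x3 x4 x5
  · refine ne_top_of_le_ne_top (b := 1 * (B * (B * (B * C)))) (by finiteness) ?_
    calc I5 d ≤ ∫⁻ x1, ww x1 * (1 * (B * (B * (B * C)))) := by
          apply lintegral_mono; intro x1; show ww x1 * _ ≤ ww x1 * _; gcongr; exact b2 x1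
      _ = _ := by rw [lintegral_mul_const _ (by fun_prop), lint_ww, one_mul]

lemma pi_succ {n : ℕ} (F : (Fin (n+1) → ℝ) → ℝ≥0∞) (hF : Measurable F) :
    ∫⁻ x, F x = ∫⁻ a, ∫⁻ y : Fin n → ℝ, F (Matrix.vecCons a y) := by
  have h := volume_preserving_piFinSuccAbove (fun _ : Fin (n+1) => ℝ) 0
  have h2 := h.symm.lintegral_comp hF
  rw [← h2, Measure.volume_eq_prod, lintegral_prod _ (by fun_prop)]
  congr 1; ext a; congr 1; ext y; congr 1; ext i
  refine Fin.cases ?_ (fun j => ?_) i <;> simp [MeasurableEquiv.piFinSuccAbove]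

@[fun_prop]
lemma measurable_vecCons {α : Type*} [MeasurableSpace α] {n : ℕ} {f : α → ℝ} {g : α → Fin n → ℝ}
    (hf : Measurable f) (hg : Measurable g) :
    Measurable (fun x => (Matrix.vecCons (f x) (g x) : Fin (n+1) → ℝ)) := by
  rw [measurable_pi_iff]
  intro i
  refine Fin.cases ?_ (fun j => ?_) i
  · simpa using hf
  · simp only [Matrix.cons_val_succ]
    exact (measurable_pi_apply j).comp hg

lemma pi5 (F : (Fin 5 → ℝ) → ℝ≥0∞) (hF : Measurable F) :
    ∫⁻ x, F x = ∫⁻ a, ∫⁻ b, ∫⁻ c, ∫⁻ e, ∫⁻ f, F ![a,b,c,e,f] := by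
  rw [pi_succ F hF]; congr 1; ext a
  rw [pi_succ _ (by fun_prop)]; congr 1; ext b
  rw [pi_succ _ (by fun_prop)]; congr 1; ext c
  rw [pi_succ _ (by fun_prop)]; congr 1; ext e
  rw [pi_succ _ (by fun_prop)]; congr 1; ext f
  rw [lintegral_unique]
  have : (volume : Measure (Fin 0 → ℝ)) univ = 1 := by
    simp [volume_pi]
  rw [this, mul_one]
  congr

noncomputable def FF (d : ℝ) (x : Fin 5 → ℝ) : ℝ≥0∞ := ∏ i, KK d (x i) (x (i+1))
noncomputable def WW (x : Fin 5 → ℝ) : ℝ≥0∞ := ∏ i, ww (x i)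

@[fun_prop] lemma measurable_FF (d : ℝ) : Measurable (FF d) := by
  unfold FF; exact Finset.measurable_prod _ fun i _ => by fun_prop
@[fun_prop] lemma measurable_WW : Measurable WW := by
  unfold WW; exact Finset.measurable_prod _ fun i _ => by fun_prop

lemma I5_eq (d : ℝ) : I5 d = ∫⁻ x, WW x * FF d x := by
  rw [pi5 _ (by fun_prop), I5]
  congr 1; ext x1
  rw [← lintegral_const_mul _ (by unfold f5; fun_prop)]; congr 1; ext x2
  rw [← mul_assoc, ← lintegral_const_mul _ (by unfold f5; fun_prop)]; congr 1; ext x3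
  rw [← mul_assoc, ← lintegral_const_mul _ (by unfold f5; fun_prop)]; congr 1; ext x4
  rw [← mul_assoc, ← lintegral_const_mul _ (by unfold f5; fun_prop)]; congr 1; ext x5
  rw [WW, FF, f5, Fin.prod_univ_five, Fin.prod_univ_five]
  simp only [← mul_assoc]
  rfl

def EE (i j : Fin 5) : Set (Fin 5 → ℝ) := {x | (∀ k, k ≠ i → x i < x k) ∧ ∀ k, k ≠ j → x k < x j}

lemma measurableSet_EE (i j : Fin 5) : MeasurableSet (EE i j) := by
  unfold EE
  have h1 : ∀ i k : Fin 5, MeasurableSet {x : Fin 5 → ℝ | x i < x k} := fun i k =>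
    measurableSet_lt (by fun_prop) (by fun_prop)
  simp only [ofPred_and, ofPred_forall]
  refine MeasurableSet.inter ?_ ?_ <;>
  exact MeasurableSet.iInter fun k => MeasurableSet.iInter fun _ => h1 _ _

noncomputable def JJ (H : (Fin 5 → ℝ) → ℝ≥0∞) (i j : Fin 5) : ℝ≥0∞ :=
  ∫⁻ x, (EE i j).indicator (fun x => WW x * H x) x

lemma perm_lint (σ : Equiv.Perm (Fin 5)) (F : (Fin 5 → ℝ) → ℝ≥0∞) (hF : Measurable F) :
    ∫⁻ x : Fin 5 → ℝ, F (fun i => x (σ i)) = ∫⁻ x, F x := by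
  have h := volume_measurePreserving_piCongrLeft (fun _ : Fin 5 => ℝ) σ
  rw [← h.symm.lintegral_comp hF]
  rfl

lemma WW_perm (σ : Equiv.Perm (Fin 5)) (x : Fin 5 → ℝ) : WW (fun i => x (σ i)) = WW x := by
  unfold WW; exact Equiv.prod_comp σ (fun i => ww (x i))

lemma JJ_perm (σ : Equiv.Perm (Fin 5)) (H : (Fin 5 → ℝ) → ℝ≥0∞) (hH : Measurable H) (i j : Fin 5) :
    JJ (fun x => H (fun i => x (σ i))) (σ i) (σ j) = JJ H i j := by
  rw [JJ, JJ, ← perm_lint σ _ (Measurable.indicator (by fun_prop) (measurableSet_EE i j))]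
  congr 1; ext x
  have : x ∈ EE (σ i) (σ j) ↔ (fun i => x (σ i)) ∈ EE i j := by
    simp only [EE, mem_ofPred_eq]
    refine and_congr ?_ ?_
    · rw [← σ.forall_congr_right]; simp
    · rw [← σ.forall_congr_right]; simp
  by_cases h : x ∈ EE (σ i) (σ j)
  · rw [indicator_of_mem h, indicator_of_mem (this.1 h), WW_perm]
  · rw [indicator_of_notMem h, indicator_of_notMem (fun h' => h (this.2 h'))]

lemma ae_inj : ∀ᵐ x : Fin 5 → ℝ, Function.Injective x := by
  have h : ∀ i j : Fin 5, i ≠ j → ∀ᵐ x : Fin 5 → ℝ, x i ≠ x j := by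
    intro i j hij
    let S : Submodule ℝ (Fin 5 → ℝ) := LinearMap.ker
      ((LinearMap.proj i : (Fin 5 → ℝ) →ₗ[ℝ] ℝ) - LinearMap.proj j)
    have hS : S ≠ ⊤ := by
      intro h
      have : Pi.single i (1:ℝ) ∈ S := by rw [h]; trivial
      simp [S, LinearMap.mem_ker, hij.symm] at this
    have := Measure.addHaar_submodule (volume : Measure (Fin 5 → ℝ)) S hS
    rw [ae_iff]
    convert this using 2
    ext x; simp [S, LinearMap.mem_ker, sub_eq_zero]
  have : ∀ᵐ x : Fin 5 → ℝ, ∀ i j : Fin 5, i ≠ j → x i ≠ x j := by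
    rw [ae_all_iff]; intro i; rw [ae_all_iff]; intro j
    by_cases hij : i = j
    · simp [hij]
    · simpa [hij] using h i j hij
  filter_upwards [this] with x hx i j hij
  by_contra hne; exact hx i j hne hij

lemma lint_split (H : (Fin 5 → ℝ) → ℝ≥0∞) (hH : Measurable H) :
    ∫⁻ x, WW x * H x = ∑ i, ∑ j, JJ H i j := by
  have hm : ∀ i j, Measurable ((EE i j).indicator (fun x => WW x * H x)) := fun i j =>
    Measurable.indicator (by fun_prop) (measurableSet_EE i j)
  unfold JJ
  simp_rw [← lintegral_finsetSum (Finset.univ) (fun j _ => hm _ j)]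
  rw [← lintegral_finsetSum]
  swap
  · intro i _; exact Finset.measurable_sum _ fun j _ => hm i j
  apply lintegral_congr_ae
  filter_upwards [ae_inj] with x hx
  obtain ⟨i, -, hi⟩ := Finset.exists_min_image Finset.univ x ⟨0, Finset.mem_univ _⟩
  obtain ⟨j, -, hj⟩ := Finset.exists_max_image Finset.univ x ⟨0, Finset.mem_univ _⟩
  have hij : x ∈ EE i j := ⟨fun k hk => lt_of_le_of_ne (hi k (Finset.mem_univ _)) (fun h => hk (hx h).symm),
    fun k hk => lt_of_le_of_ne (hj k (Finset.mem_univ _)) (fun h => hk (hx h))⟩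
  rw [Finset.sum_eq_single i, Finset.sum_eq_single j, indicator_of_mem hij]
  · intro j' _ hj'
    apply indicator_of_notMem
    intro h
    exact absurd (h.2 j hj'.symm) (not_lt.2 (hj j' (Finset.mem_univ _)))
  · simp
  · intro i' _ hi'
    apply Finset.sum_eq_zero; intro j' _
    apply indicator_of_notMem
    intro h
    exact absurd (h.1 i hi'.symm) (not_lt.2 (hi i' (Finset.mem_univ _)))
  · simp

lemma FF_rot (d : ℝ) (c : Fin 5) (x : Fin 5 → ℝ) : FF d (fun i => x (Equiv.addRight c i)) = FF d x := by
  unfold FF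
  rw [← Equiv.prod_comp (Equiv.addRight c) (fun i => KK d (x i) (x (i+1)))]
  congr 1; ext i
  simp only [Equiv.coe_addRight]
  rw [add_right_comm]

lemma FF_neg (d : ℝ) (x : Fin 5 → ℝ) : FF d (fun i => x (Equiv.neg _ i)) = FF d x := by
  unfold FF
  rw [← Equiv.prod_comp ((Equiv.neg (Fin 5)).trans (Equiv.addRight (-1))) (fun i => KK d (x i) (x (i+1)))]
  congr 1; ext i
  rw [KK_comm]
  simp only [Equiv.neg_apply, Equiv.trans_apply, Equiv.coe_addRight]
  congr 2 <;> abel_nf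

lemma JJ_rot (d : ℝ) (i j : Fin 5) : JJ (FF d) i j = JJ (FF d) 0 (j - i) := by
  have := JJ_perm (Equiv.addRight i) (FF d) (by fun_prop) 0 (j-i)
  simp_rw [FF_rot] at this
  rw [← this]; simp

lemma JJ_neg (d : ℝ) (j : Fin 5) : JJ (FF d) 0 (-j) = JJ (FF d) 0 j := by
  have := JJ_perm (Equiv.neg (Fin 5)) (FF d) (by fun_prop) 0 j
  simp_rw [FF_neg] at this
  rw [← this]; simp

lemma JJ_diag (d : ℝ) : JJ (FF d) 0 0 = 0 := by
  have : EE 0 0 = ∅ := by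
    ext x; simp only [EE, mem_ofPred_eq, mem_empty_iff_false, iff_false]
    rintro ⟨h1, h2⟩
    exact absurd (h1 1 (by decide)) (not_lt.2 (h2 1 (by decide)).le)
  rw [JJ, this]; simp

lemma I5_J (d : ℝ) : I5 d = 10 * (JJ (FF d) 0 1 + JJ (FF d) 0 2) := by
  rw [I5_eq, lint_split _ (by fun_prop)]
  have h : ∀ i : Fin 5, ∑ j, JJ (FF d) i j = ∑ j, JJ (FF d) 0 j := fun i => by
    rw [← Equiv.sum_comp (Equiv.subRight i) (fun j => JJ (FF d) 0 j)]
    exact Finset.sum_congr rfl fun j _ => JJ_rot d i j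
  rw [Finset.sum_congr rfl fun i _ => h i]
  have h3 : JJ (FF d) 0 3 = JJ (FF d) 0 2 := JJ_neg d 2
  have h4 : JJ (FF d) 0 4 = JJ (FF d) 0 1 := JJ_neg d 1
  rw [Finset.sum_const, Fin.sum_univ_five, h3, h4, JJ_diag]
  simp; ring

lemma qq0 {u : ℝ} (h : 0 < u) : qq 0 u = 1 := by rw [qq_pos h]; simp

noncomputable def VV (a b u : ℝ) : ℝ≥0∞ := qq 0 (u-a) * qq 0 (b-u)

@[fun_prop]
lemma measurable_VV {α : Type*} [MeasurableSpace α] {f g h : α → ℝ} (hf : Measurable f)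
    (hg : Measurable g) (hh : Measurable h) :
    Measurable (fun x => VV (f x) (g x) (h x)) := by unfold VV; fun_prop

lemma VV_scale {a b : ℝ} (h : a < b) (t : ℝ) : VV a b (a + (b-a)*t) = ww t := by
  have hr : 0 < b - a := by linarith
  rw [VV, ww, show a + (b-a)*t - a = (b-a)*t by ring, show b-(a + (b-a)*t) = (b-a)*(1-t) by ring,
    qq_scale hr, qq_scale hr]; simp

lemma VV_zero {a b u : ℝ} (h : ¬ (a < u ∧ u < b)) : VV a b u = 0 := by
  rw [VV]
  by_cases h1 : a < u
  · have : ¬ u < b := fun h2 => h ⟨h1, h2⟩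
    rw [qq_neg (u := b - u) (by linarith), mul_zero]
  · rw [qq_neg (u := u - a) (by linarith), zero_mul]

lemma VV_one {a b u : ℝ} (h : a < u) (h2 : u < b) : VV a b u = 1 := by
  rw [VV, qq0 (by linarith), qq0 (by linarith), one_mul]

lemma ww_one {u : ℝ} (h : 0 < u) (h2 : u < 1) : ww u = 1 := by
  rw [ww, qq0 (by linarith), qq0 (by linarith), one_mul]

lemma ww_zero {u : ℝ} (h : ¬ (0 < u ∧ u < 1)) : ww u = 0 := by
  have h' : u ∉ Set.Ioo (0:ℝ) 1 := h
  rw [ww_eq, Set.indicator_of_notMem h']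

lemma mem_EE01 (a b u v t : ℝ) : ![a,b,u,v,t] ∈ EE 0 1 ↔
    a < b ∧ (a < u ∧ u < b) ∧ (a < v ∧ v < b) ∧ (a < t ∧ t < b) := by
  simp only [EE, mem_ofPred_eq]
  constructor
  · rintro ⟨h1, h2⟩
    exact ⟨h1 1 (by decide), ⟨h1 2 (by decide), h2 2 (by decide)⟩,
      ⟨h1 3 (by decide), h2 3 (by decide)⟩, ⟨h1 4 (by decide), h2 4 (by decide)⟩⟩
  · rintro ⟨h, hu, hv, ht⟩
    constructor <;> intro k hk <;> fin_cases k <;> simp at hk ⊢ <;> tauto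

lemma indic01 (H : (Fin 5 → ℝ) → ℝ≥0∞) (a b u v t : ℝ) :
    (EE 0 1).indicator (fun x => WW x * H x) ![a,b,u,v,t] =
    ww a * ww b * qq 0 (b-a) * (VV a b u * (VV a b v * (VV a b t * H ![a,b,u,v,t]))) := by
  have hW : WW ![a,b,u,v,t] = ww a * ww b * ww u * ww v * ww t := by
    rw [WW, Fin.prod_univ_five]; rfl
  by_cases h : ![a,b,u,v,t] ∈ EE 0 1
  · rw [indicator_of_mem h, hW]
    obtain ⟨h, hu, hv, ht⟩ := (mem_EE01 a b u v t).1 h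
    rw [qq0 (by linarith), VV_one hu.1 hu.2, VV_one hv.1 hv.2, VV_one ht.1 ht.2]
    by_cases ha : 0 < a ∧ a < 1
    · by_cases hb : 0 < b ∧ b < 1
      · rw [ww_one (u := u) (by linarith) (by linarith), ww_one (u := v) (by linarith) (by linarith),
          ww_one (u := t) (by linarith) (by linarith)]
        ring
      · simp [ww_zero hb]
    · simp [ww_zero ha]
  · rw [indicator_of_notMem h]
    rw [mem_EE01] at h
    by_cases h1 : a < b
    · by_cases hu : a < u ∧ u < b
      · by_cases hv : a < v ∧ v < b
        · by_cases ht : a < t ∧ t < b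
          · exact absurd ⟨h1, hu, hv, ht⟩ h
          · simp [VV_zero ht]
        · simp [VV_zero hv]
      · simp [VV_zero hu]
    · simp [qq_neg (u := b - a) (by linarith)]

noncomputable def T3 (H : (Fin 5 → ℝ) → ℝ≥0∞) : ℝ≥0∞ :=
  ∫⁻ u, ∫⁻ v, ∫⁻ t, ww u * (ww v * (ww t * H ![0,1,u,v,t]))

lemma inner_scale {d : ℝ} (H : (Fin 5 → ℝ) → ℝ≥0∞) (hH : Measurable H)
    (hom : ∀ (a r : ℝ), 0 < r → ∀ x, H (fun i => a + r * x i) = ENNReal.ofReal (r ^ (-5*d)) * H x)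
    (a b : ℝ) :
    ∫⁻ u, ∫⁻ v, ∫⁻ t, qq 0 (b-a) * (VV a b u * (VV a b v * (VV a b t * H ![a,b,u,v,t]))) =
      qq (3-5*d) (b-a) * T3 H := by
  by_cases h : a < b
  · have hr : 0 < b - a := by linarith
    set r := b - a with hrdef
    have hb : b = a + r := by rw [hrdef]; ring
    rw [qq0 hr]
    simp_rw [one_mul]
    rw [lint_affine _ (by fun_prop) a hr]
    simp_rw [fun u => lint_affine (fun v => ∫⁻ t, VV a b (a + r * u) * (VV a b v * (VV a b t *
      H ![a,b,a + r * u,v,t]))) (by fun_prop) a hr]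
    simp_rw [fun u v => lint_affine (fun t => VV a b (a + r * u) * (VV a b (a + r * v) * (VV a b t *
      H ![a,b,a + r * u,a + r * v,t]))) (by fun_prop) a hr]
    have hv : ∀ t, VV a b (a + r * t) = ww t := fun t => VV_scale h t
    have hh : ∀ u v t, H ![a,b,a + r * u,a + r * v,a + r * t] =
        ENNReal.ofReal (r ^ (-5*d)) * H ![0,1,u,v,t] := by
      intro u v t
      rw [← hom a r hr]
      congr 1; ext i; fin_cases i <;> simp [hb]
    simp_rw [hv, hh]
    have hc : ∀ u v t, ww u * (ww v * (ww t * (ENNReal.ofReal (r ^ (-5*d)) * H ![0,1,u,v,t]))) =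
      ENNReal.ofReal (r ^ (-5*d)) * (ww u * (ww v * (ww t * H ![0,1,u,v,t]))) := by
      intro u v t; ring
    simp_rw [hc]
    simp_rw [lintegral_const_mul' _ _ ENNReal.ofReal_ne_top]
    rw [← T3, qq_pos hr]
    simp_rw [← mul_assoc]
    congr 1
    rw [← ENNReal.ofReal_mul (by positivity), ← ENNReal.ofReal_mul (by positivity),
      ← ENNReal.ofReal_mul (by positivity)]
    congr 1
    rw [show 3-5*d = 3 + (-5*d) by ring, Real.rpow_add hr]
    norm_cast
    ring
  · simp [qq_neg (u := b - a) (by linarith)]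

lemma outer_int {d : ℝ} (hd1 : d < 1/2) :
    ∫⁻ a, ∫⁻ b, ww a * ww b * qq (3-5*d) (b-a) =
      ENNReal.ofReal (Real.Gamma (4-5*d) / Real.Gamma (6-5*d)) := by
  have e : ∀ a, ∫⁻ b, ww a * ww b * qq (3-5*d) (b-a) =
     ENNReal.ofReal (ProbabilityTheory.beta (4-5*d) 1) * (qq (1-1) a * qq (5-5*d-1) (1-a)) := by
    intro a
    have h := conv_lint (α := 4-5*d) (β := 1) (by linarith) one_pos a 1
    rw [sub_self, show 4-5*d-1 = 3-5*d by ring, show 4-5*d+1-1 = 5-5*d-1 by ring] at h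
    rw [sub_self, mul_left_comm, ← h, ← lintegral_const_mul _ (by fun_prop)]
    congr 1; ext b
    by_cases hab : a < b
    · by_cases h0 : 0 < a
      · by_cases h1 : b < 1
        · rw [ww_one h0 (by linarith), ww_one (by linarith) h1, qq0 h0,
            qq0 (u := 1 - b) (by linarith)]; ring
        · simp [ww, qq_neg (u := 1 - b) (by linarith)]
      · simp [ww, qq_neg (u := a) (by linarith)]
    · simp [qq_neg (u := b - a) (by linarith)]
  simp_rw [e]
  rw [lintegral_const_mul _ (by fun_prop), beta_lint one_pos (by linarith),
    beta_one_right (by linarith), ProbabilityTheory.beta,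
    ← ENNReal.ofReal_mul (by have : 0 < 4 - 5*d := by linarith
                             positivity)]
  congr 1
  have h4 : 0 < 4 - 5*d := by linarith
  have h5 : 0 < 5 - 5*d := by linarith
  have g4 := Real.Gamma_pos_of_pos h4
  rw [show 1 + (5-5*d) = 5-5*d+1 by ring, show 6-5*d = 5-5*d+1 by ring,
    Real.Gamma_add_one h5.ne', show 5-5*d = 4-5*d+1 by ring, Real.Gamma_add_one h4.ne',
    Real.Gamma_one]
  field_simp

lemma JJ01 {d : ℝ} (hd1 : d < 1/2) (H : (Fin 5 → ℝ) → ℝ≥0∞) (hH : Measurable H)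
    (hom : ∀ (a r : ℝ), 0 < r → ∀ x, H (fun i => a + r * x i) = ENNReal.ofReal (r ^ (-5*d)) * H x) :
    JJ H 0 1 = ENNReal.ofReal (Real.Gamma (4-5*d) / Real.Gamma (6-5*d)) * T3 H := by
  rw [JJ, pi5 _ (Measurable.indicator (by fun_prop) (measurableSet_EE 0 1))]
  simp_rw [indic01]
  have e : ∀ a b, ∫⁻ u, ∫⁻ v, ∫⁻ t, ww a * ww b * qq 0 (b-a) *
      (VV a b u * (VV a b v * (VV a b t * H ![a,b,u,v,t]))) =
      ww a * ww b * qq (3-5*d) (b-a) * T3 H := by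
    intro a b
    simp_rw [mul_assoc (ww a * ww b)]
    rw [← inner_scale H hH hom, ← lintegral_const_mul _ (by fun_prop)]
    congr 1; ext u
    rw [← lintegral_const_mul _ (by fun_prop)]
    congr 1; ext v
    rw [← lintegral_const_mul _ (by fun_prop)]
  simp_rw [e]
  rw [← outer_int hd1, ← lintegral_mul_const _ (by fun_prop)]
  congr 1; ext a
  rw [lintegral_mul_const _ (by fun_prop)]

lemma KK_scale (d a : ℝ) {r : ℝ} (hr : 0 < r) (x y : ℝ) :
    KK d (a + r*x) (a + r*y) = ENNReal.ofReal (r ^ (-d)) * KK d x y := by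
  rw [KK, KK, show a + r*x - (a + r*y) = r*(x-y) by ring, show a + r*y - (a + r*x) = r*(y-x) by ring,
    qq_scale hr, qq_scale hr]; ring

lemma FF_hom (d : ℝ) (a r : ℝ) (hr : 0 < r) (x : Fin 5 → ℝ) :
    FF d (fun i => a + r * x i) = ENNReal.ofReal (r ^ (-5*d)) * FF d x := by
  unfold FF
  simp_rw [KK_scale d a hr]
  rw [Finset.prod_mul_distrib, Finset.prod_const, ← ENNReal.ofReal_pow (by positivity)]
  congr 2
  rw [← Real.rpow_natCast, ← Real.rpow_mul hr.le]
  congr 1; simp; ring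

lemma KK_one {d u : ℝ} (h : u < 1) : KK d 1 u = qq (-d) (1-u) := by
  rw [KK, qq_neg (u := u - 1) (by linarith), add_zero]
lemma KK_zero {d u : ℝ} (h : 0 < u) : KK d u 0 = qq (-d) u := by
  rw [KK, qq_neg (u := 0 - u) (by linarith), add_zero, sub_zero]

lemma ww_KK_one (d u : ℝ) : ww u * KK d 1 u = wl d u := by
  by_cases h : u < 1
  · rw [KK_one h, ww, wl, qq0 (u := 1 - u) (by linarith)]; ring
  · rw [ww, wl, qq_neg (u := 1 - u) (by linarith), qq_neg (u := 1 - u) (by linarith)]; simp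

lemma ww_KK_zero (d u : ℝ) : ww u * KK d u 0 = wr d u := by
  by_cases h : 0 < u
  · rw [KK_zero h, ww, wr, qq0 h]; ring
  · rw [ww, wr, qq_neg (u := u) (by linarith), qq_neg (u := u) (by linarith)]; simp

lemma T3_FF (d : ℝ) : T3 (FF d) = AA d := by
  rw [T3, AA]
  congr 1; ext u; congr 1; ext v; congr 1; ext t
  have h : FF d ![0,1,u,v,t] = KK d 0 1 * KK d 1 u * KK d u v * KK d v t * KK d t 0 := by
    rw [FF, Fin.prod_univ_five]; rfl
  have h1 : KK d 0 1 = 1 := by rw [KK_comm, KK_zero one_pos, qq_pos one_pos]; simp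
  rw [h, h1, ← ww_KK_one, ← ww_KK_zero, ← ww]; ring

lemma T3_FF2 {d : ℝ} (hd1 : d < 1) :
    T3 (fun x => FF d (fun i => x (Equiv.swap 1 2 i))) = bE d * DD d := by
  have e : ∀ u v t, ww u * (ww v * (ww t * FF d (fun i => ![0,1,u,v,t] (Equiv.swap 1 2 i)))) =
     (qq (1-d-1) u * qq (1-d-1) (1-u)) * (wl d v * KK d v t * wr d t) := by
    intro u v t
    have h : FF d (fun i => ![0,1,u,v,t] (Equiv.swap 1 2 i)) =
        KK d 0 u * KK d u 1 * KK d 1 v * KK d v t * KK d t 0 := by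
      rw [FF, Fin.prod_univ_five]; rfl
    rw [h, ← ww_KK_one, ← ww_KK_zero]
    have h2 : ww u * (KK d 0 u * KK d u 1) = qq (1-d-1) u * qq (1-d-1) (1-u) := by
      rw [show 1-d-1 = -d by ring]
      by_cases hu : 0 < u ∧ u < 1
      · rw [ww_one hu.1 hu.2, KK_comm d 0, KK_comm d u 1, KK_zero hu.1, KK_one hu.2, one_mul]
      · rw [ww_zero hu, zero_mul]
        by_cases h0 : 0 < u
        · have : ¬ u < 1 := fun h => hu ⟨h0, h⟩
          rw [qq_neg (u := 1 - u) (by linarith), mul_zero]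
        · rw [qq_neg (u := u) (by linarith), zero_mul]
    rw [← h2]; ring
  rw [T3]
  simp_rw [e]
  rw [bE, ← beta_lint (by linarith) (by linarith), ← lintegral_mul_const _ (by fun_prop)]
  congr 1; ext u
  rw [DD, ← lintegral_const_mul _ (by fun_prop)]
  congr 1; ext v
  rw [← lintegral_const_mul _ (by fun_prop)]

lemma I5_final {d : ℝ} (hd1 : d < 1/2) :
    I5 d = 10 * (ENNReal.ofReal (Real.Gamma (4-5*d) / Real.Gamma (6-5*d)) *
      (AA d + bE d * DD d)) := by
  have hm : Measurable (fun x : Fin 5 → ℝ => FF d (fun i => x (Equiv.swap 1 2 i))) := by fun_prop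
  have h := JJ_perm (Equiv.swap 1 2) (FF d) (by fun_prop) 0 2
  have h2 : JJ (FF d) 0 2 = JJ (fun x => FF d (fun i => x (Equiv.swap 1 2 i))) 0 1 := by
    rw [← h]; rfl
  rw [I5_J, h2, JJ01 hd1 _ hm (fun a r hr x => FF_hom d a r hr _),
    JJ01 hd1 _ (by fun_prop) (FF_hom d), T3_FF, T3_FF2 (by linarith)]
  ring

lemma fin_mul {c : ℝ} {x : ENNReal} (hc : 0 < c) (h : ENNReal.ofReal c * x ≠ ⊤) : x ≠ ⊤ := by
  rintro rfl
  exact h (ENNReal.mul_top (ENNReal.ofReal_pos.2 hc).ne')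

lemma fin_aux {g b a k1 k2 k3 k4 k5 : ℝ} {e1 e2 e3 e4 e5 : ENNReal} (hg : 0 < g) (hb : 0 < b)
    (ha : 0 < a) (h1 : 0 < k1) (h2 : 0 < k2) (h3 : 0 < k3) (h4 : 0 < k4) (h5 : 0 < k5)
    (h : (10 * (ENNReal.ofReal g * (ENNReal.ofReal b * ENNReal.ofReal b * ENNReal.ofReal a +
      2 * (ENNReal.ofReal b * (ENNReal.ofReal k1 * e1)) +
      ENNReal.ofReal b * (ENNReal.ofReal k2 * e2) +
      ENNReal.ofReal b * (ENNReal.ofReal k3 * e3 + ENNReal.ofReal k4 * e4 +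
        ENNReal.ofReal k5 * e5))) : ENNReal) ≠ ⊤) :
    (10 * (ENNReal.ofReal g * (ENNReal.ofReal b * ENNReal.ofReal b * ENNReal.ofReal a +
      2 * (ENNReal.ofReal b * (ENNReal.ofReal k1 * e1)) +
      ENNReal.ofReal b * (ENNReal.ofReal k2 * e2) +
      ENNReal.ofReal b * (ENNReal.ofReal k3 * e3 + ENNReal.ofReal k4 * e4 +
        ENNReal.ofReal k5 * e5))) : ENNReal).toReal =
    10 * (g * (b * b * a + 2 * (b * (k1 * e1.toReal)) + b * (k2 * e2.toReal) +
      b * (k3 * e3.toReal + k4 * e4.toReal + k5 * e5.toReal))) := by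
  have q : ENNReal.ofReal 10 = 10 := by norm_num
  have q2 : ENNReal.ofReal 2 = 2 := by norm_num
  have j := fin_mul (c := 10) (by norm_num) (by rw [q]; exact h)
  have j := fin_mul hg j
  obtain ⟨j, j3⟩ := ENNReal.add_ne_top.1 j
  obtain ⟨j, j2⟩ := ENNReal.add_ne_top.1 j
  obtain ⟨-, j1⟩ := ENNReal.add_ne_top.1 j
  have j1 := fin_mul h1 (fin_mul hb (fin_mul (c := 2) (by norm_num) (by rw [q2]; exact j1)))
  have j2 := fin_mul h2 (fin_mul hb j2)
  obtain ⟨j, j5⟩ := ENNReal.add_ne_top.1 (fin_mul hb j3)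
  obtain ⟨j3, j4⟩ := ENNReal.add_ne_top.1 j
  have j3 := fin_mul h3 j3
  have j4 := fin_mul h4 j4
  have j5 := fin_mul h5 j5
  lift e1 to NNReal using j1
  lift e2 to NNReal using j2
  lift e3 to NNReal using j3
  lift e4 to NNReal using j4
  lift e5 to NNReal using j5
  lift g to NNReal using hg.le
  lift a to NNReal using ha.le
  lift b to NNReal using hb.le
  lift k1 to NNReal using h1.le
  lift k2 to NNReal using h2.le
  lift k3 to NNReal using h3.le
  lift k4 to NNReal using h4.le
  lift k5 to NNReal using h5.le
  simp only [ENNReal.ofReal_coe_nnreal, ENNReal.coe_toReal]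
  norm_cast

theorem rosenblatt_fifth_cumulant (d : ℝ) (h0 : 0 < d) (h1 : d < 1/2) :
    2 ^ 4 * (Nat.factorial 4 : ℝ) * ((1/2) * (1 - 2*d) * (1 - d)) ^ ((5:ℝ)/2) * c5 d =
      3840 * ((1/2) * (1 - 2*d) * (1 - d)) ^ ((5:ℝ)/2) * (Gamma (4-5*d) / Gamma (6-5*d)) *
        (Gamma (1-d) ^ 4 / Gamma (4-4*d) +
         Gamma (1-d) ^ 3 / ((1-d) * Gamma (2-2*d)) * (Gamma (3-3*d) / Gamma (4-4*d)) *
           F32 d (1-d) (3-3*d) (2-d) (4-4*d) +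
         Gamma (1-d) ^ 2 * Gamma (2-2*d) / ((1-d) * Gamma (4-4*d)) *
           F32 d (1-d) (2-2*d) (2-d) (4-4*d) +
         Gamma (1-d) ^ 2 / (3 * (1-d) * Gamma (3-2*d)) *
           F32 1 d (3-3*d) (3-2*d) (4-3*d) +
         2 * Gamma (1-d) ^ 2 / (3 * (1-d) ^ 2 * Gamma (2-2*d)) *
           F32 1 d (3-3*d) (2-d) (4-3*d) +
         Gamma (1-d) ^ 2 / ((1-d) * Gamma (3-2*d)) *
           F32 1 d (2-2*d) (2-d) (3-2*d)) := by
  obtain ⟨hc, hfin⟩ := c5_eq h0 h1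
  have p1 : 0 < 1 - d := by linarith
  have p2 : 0 < 2 - 2*d := by linarith
  have p4 : 0 < 4 - 4*d := by linarith
  have g1 := Real.Gamma_pos_of_pos p1
  have g2 := Real.Gamma_pos_of_pos p2
  have g3 := Real.Gamma_pos_of_pos (s := 3-3*d) (by linarith)
  have g4 := Real.Gamma_pos_of_pos p4
  have gr1 := Real.Gamma_pos_of_pos (s := 4-5*d) (by linarith)
  have gr2 := Real.Gamma_pos_of_pos (s := 6-5*d) (by linarith)
  have hG3 : Gamma (3-2*d) = (2-2*d) * Gamma (2-2*d) := by
    rw [← Real.Gamma_add_one p2.ne']; congr 1; ring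
  rw [I5_final h1, AA_eq (by linarith), DD_eq (by linarith), ← N_sum (by linarith),
    Mint_eq h0 (by linarith) (by linarith), Mint_eq h0 (by linarith) (by linarith),
    Mint_eq h0 (by linarith) (by linarith), Nint_eq h0 (by linarith) (by linarith) (by linarith),
    Nint_eq h0 (by linarith) (by linarith) (by linarith)] at hc hfin
  rw [show 1-2*d+(1-d)+1 = 3-3*d by ring, show 1-d+1 = 2-d by ring,
    show 1-2*d+(1-d)+2 = 4-3*d by ring, show -d+(2-2*d)+1 = 3-3*d by ring,
    show 2-2*d+1 = 3-2*d by ring, show -d+(2-2*d)+2 = 4-3*d by ring,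
    show 2-2*d+(1-d)+1-d = 4-4*d by ring, show 3-2*d-d = 3-3*d by ring,
    show 1-d+(2-2*d)+1-d = 4-4*d by ring,
    show 2-d-d = 2-2*d by ring, show -d+(1-d)+1 = 2-2*d by ring,
    show -d+(1-d)+2 = 3-2*d by ring] at hc hfin
  have r1 := E32_toReal (a := d) (b := 1-d) (c := 3-3*d) (e := 2-d) (f := 4-4*d) h0 p1
    (by linarith) (by linarith) p4
  have r2 := E32_toReal (a := d) (b := 1-d) (c := 2-2*d) (e := 2-d) (f := 4-4*d) h0 p1
    (by linarith) (by linarith) p4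
  have r3 := E32_toReal (a := 1) (b := d) (c := 3-3*d) (e := 3-2*d) (f := 4-3*d) one_pos h0
    (by linarith) (by linarith) (by linarith)
  have r4 := E32_toReal (a := 1) (b := d) (c := 3-3*d) (e := 2-d) (f := 4-3*d) one_pos h0
    (by linarith) (by linarith) (by linarith)
  have r5 := E32_toReal (a := 1) (b := d) (c := 2-2*d) (e := 2-d) (f := 3-2*d) one_pos h0
    (by linarith) (by linarith) (by linarith)
  rw [← r1, ← r2, ← r3, ← r4, ← r5]
  have hb : ProbabilityTheory.beta (1-d) (1-d) = Gamma (1-d) * Gamma (1-d) / Gamma (2-2*d) := by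
    rw [ProbabilityTheory.beta, show 1-d+(1-d) = 2-2*d by ring]
  have hb2 : ProbabilityTheory.beta (2-2*d) (2-2*d) =
      Gamma (2-2*d) * Gamma (2-2*d) / Gamma (4-4*d) := by
    rw [ProbabilityTheory.beta, show 2-2*d+(2-2*d) = 4-4*d by ring]
  have p3 : 0 < 3 - 3*d := by linarith
  rw [bE, hb, hb2] at hc hfin
  rw [fin_aux (by positivity) (by positivity) (by positivity) (by positivity) (by positivity)
    (by positivity) (by positivity) (by positivity) hfin] at hc
  rw [hc, hG3]
  clear hc hfin r1 r2 r3 r4 r5 hb hb2 hG3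
  generalize (E32 d (1-d) (3-3*d) (2-d) (4-4*d)).toReal = e1
  generalize (E32 d (1-d) (2-2*d) (2-d) (4-4*d)).toReal = e2
  generalize (E32 1 d (3-3*d) (3-2*d) (4-3*d)).toReal = e3
  generalize (E32 1 d (3-3*d) (2-d) (4-3*d)).toReal = e4
  generalize (E32 1 d (2-2*d) (2-d) (3-2*d)).toReal = e5
  generalize ((1/2) * (1 - 2*d) * (1 - d)) ^ ((5:ℝ)/2) = R
  generalize Gamma (1-d) = G1 at *
  generalize Gamma (2-2*d) = G2 at *
  generalize Gamma (3-3*d) = G3 at *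
  generalize Gamma (4-4*d) = G4 at *
  generalize Gamma (4-5*d) = G5 at *
  generalize Gamma (6-5*d) = G6 at *
  rw [show 2-2*d = 2*(1-d) by ring, show 3-3*d = 3*(1-d) by ring]
  generalize 1-d = t at *
  norm_num [Nat.factorial]
  field_simp
  ring
end

section
/- Let d be a real number with 0 ≤ d < 1/2. Then the iterated integral ∫₀¹∫₀^{y₁}∫₀^{y₂}∫₀^{y₃} (y₁−y₂)^(−d)(y₂−y₃)^(−d)(y₃−y₄)^(−d)(y₁−y₄)^(−d) dy₄ dy₃ dy₂ dy₁ equals Γ(1−d)³·Γ(3−4d)/(Γ(3−3d)·Γ(5−4d)). -/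
open Real

open MeasureTheory Set

lemma beta_val {p q y a : ℝ} (hp : 0 < p) (hq : 0 < q) (h : y < a) :
    ∫ x in y..a, (a - x) ^ (q - 1) * (x - y) ^ (p - 1) =
      Gamma p * Gamma q / Gamma (p + q) * (a - y) ^ (p + q - 1) := by
  have e : ∫ x in y..a, (a - x) ^ (q - 1) * (x - y) ^ (p - 1) =
      ∫ x in (0:ℝ)..(a - y), x ^ (p - 1) * ((a - y) - x) ^ (q - 1) := by
    have := intervalIntegral.integral_comp_sub_right (a := y) (b := a)
      (fun x : ℝ => x ^ (p - 1) * ((a - y) - x) ^ (q - 1)) y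
    rw [sub_self] at this
    rw [← this]
    congr 1
    ext x
    rw [mul_comm]
    congr 2
    ring
  rw [e]
  have hay : 0 < a - y := sub_pos.2 h
  have key := Complex.betaIntegral_scaled (p : ℂ) (q : ℂ) hay
  rw [Complex.betaIntegral_eq_Gamma_mul_div _ _ (by simpa) (by simpa)] at key
  have : ((∫ x in (0:ℝ)..(a - y), x ^ (p - 1) * ((a - y) - x) ^ (q - 1) : ℝ) : ℂ) =
      ((Gamma p * Gamma q / Gamma (p + q) * (a - y) ^ (p + q - 1) : ℝ) : ℂ) := by
    rw [← intervalIntegral.integral_ofReal]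
    rw [Complex.ofReal_mul, Complex.ofReal_div, Complex.ofReal_mul, ← Complex.Gamma_ofReal,
      ← Complex.Gamma_ofReal, ← Complex.Gamma_ofReal, Complex.ofReal_cpow hay.le, mul_comm]
    push_cast
    push_cast at key
    rw [← key]
    rw [intervalIntegral.integral_of_le hay.le, intervalIntegral.integral_of_le hay.le]
    refine setIntegral_congr_fun measurableSet_Ioc fun x hx => ?_
    rw [Complex.ofReal_cpow hx.1.le, Complex.ofReal_cpow (by linarith [hx.2])]
    push_cast
    rfl
  exact_mod_cast this

lemma beta_int {p q y a : ℝ} (hp : 0 < p) (hq : 0 < q) (h : y < a) :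
    IntervalIntegrable (fun x => (a - x) ^ (q - 1) * (x - y) ^ (p - 1)) volume y a := by
  apply intervalIntegral.intervalIntegrable_of_integral_ne_zero
  rw [beta_val hp hq h]
  have := Gamma_pos_of_pos hp
  have := Gamma_pos_of_pos hq
  have := Gamma_pos_of_pos (add_pos hp hq)
  have := rpow_pos_of_pos (sub_pos.2 h) (p + q - 1)
  positivity

lemma tri_swap {a : ℝ} (ha : 0 ≤ a) (F : ℝ → ℝ → ℝ) (hm : Measurable (Function.uncurry F))
    (hn : ∀ x y, 0 < y → y < x → x < a → 0 ≤ F x y)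
    (h1 : ∀ y, 0 < y → y < a → IntervalIntegrable (fun x => F x y) volume y a)
    (h2 : IntervalIntegrable (fun y => ∫ x in y..a, F x y) volume 0 a) :
    ∫ x in (0:ℝ)..a, ∫ y in (0:ℝ)..x, F x y = ∫ y in (0:ℝ)..a, ∫ x in y..a, F x y := by
  classical
  let S : Set (ℝ × ℝ) := {p | 0 < p.2 ∧ p.2 < p.1 ∧ p.1 < a}
  have hS : MeasurableSet S := by
    apply MeasurableSet.inter (measurableSet_lt measurable_const measurable_snd)
    exact MeasurableSet.inter (measurableSet_lt measurable_snd measurable_fst)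
      (measurableSet_lt measurable_fst measurable_const)
  let G : ℝ → ℝ → ℝ := fun x y => S.indicator (Function.uncurry F) (x, y)
  have hG : Measurable (Function.uncurry G) := hm.indicator hS
  have hGn : ∀ x y, 0 ≤ G x y := by
    intro x y
    apply indicator_apply_nonneg
    rintro ⟨u, v, w⟩
    exact hn x y u v w
  have gx : ∀ x, (∫ y, G x y) = (Ioo 0 a).indicator (fun x => ∫ y in (0:ℝ)..x, F x y) x := by
    intro x
    by_cases hx : x ∈ Ioo 0 a
    · rw [indicator_of_mem hx, intervalIntegral.integral_of_le hx.1.le,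
        integral_Ioc_eq_integral_Ioo, ← integral_indicator measurableSet_Ioo]
      congr 1
      ext y
      simp only [G, S, indicator, mem_ofPred_eq, mem_Ioo, Function.uncurry]
      simp [hx.2]
    · rw [indicator_of_notMem hx]
      rw [← integral_zero ℝ ℝ]
      congr 1
      ext y
      apply indicator_of_notMem
      rintro ⟨u, v, w⟩
      exact hx ⟨u.trans v, w⟩
  have gy' : ∀ y, 0 < y → y < a → (fun x => G x y) = (Ioo y a).indicator (fun x => F x y) := by
    intro y hy _
    ext x
    simp only [G, S, indicator, mem_ofPred_eq, mem_Ioo, Function.uncurry]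
    simp [hy]
  have gy0 : ∀ y, y ∉ Ioo 0 a → (fun x => G x y) = fun _ => 0 := by
    intro y hy
    ext x
    apply indicator_of_notMem
    rintro ⟨u, v, w⟩
    exact hy ⟨u, v.trans w⟩
  have gy : ∀ y, (∫ x, G x y) = (Ioo 0 a).indicator (fun y => ∫ x in y..a, F x y) y := by
    intro y
    by_cases hy : y ∈ Ioo 0 a
    · rw [indicator_of_mem hy, gy' y hy.1 hy.2, intervalIntegral.integral_of_le hy.2.le,
        integral_Ioc_eq_integral_Ioo, ← integral_indicator measurableSet_Ioo]
    · rw [indicator_of_notMem hy, gy0 y hy]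
      simp
  have hint : Integrable (Function.uncurry G) (volume.prod volume) := by
    rw [integrable_prod_iff' hG.aestronglyMeasurable]
    constructor
    · refine Filter.Eventually.of_forall fun y => ?_
      change Integrable (fun x => G x y) volume
      by_cases hy : y ∈ Ioo 0 a
      · rw [gy' y hy.1 hy.2, integrable_indicator_iff measurableSet_Ioo]
        exact ((intervalIntegrable_iff_integrableOn_Ioo_of_le hy.2.le).1 (h1 y hy.1 hy.2))
      · rw [gy0 y hy]
        exact integrable_zero _ _ _
    · have : (fun y => ∫ x, ‖Function.uncurry G (x, y)‖) =
          (Ioo 0 a).indicator (fun y => ∫ x in y..a, F x y) := by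
        ext y
        rw [← gy y]
        congr 1
        ext x
        exact Real.norm_of_nonneg (hGn x y)
      rw [this, integrable_indicator_iff measurableSet_Ioo]
      exact ((intervalIntegrable_iff_integrableOn_Ioo_of_le ha).1 h2)
  have sw := integral_integral_swap hint
  simp only [gx, gy] at sw
  rw [integral_indicator measurableSet_Ioo, integral_indicator measurableSet_Ioo,
    ← integral_Ioc_eq_integral_Ioo, ← integral_Ioc_eq_integral_Ioo,
    ← intervalIntegral.integral_of_le ha, ← intervalIntegral.integral_of_le ha] at sw
  exact sw

lemma icongr {a b : ℝ} (hab : a ≤ b) {f g : ℝ → ℝ} (h : ∀ x, a < x → x < b → f x = g x) :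
    ∫ x in a..b, f x = ∫ x in a..b, g x := by
  rw [intervalIntegral.integral_of_le hab, intervalIntegral.integral_of_le hab,
    integral_Ioc_eq_integral_Ioo, integral_Ioc_eq_integral_Ioo]
  exact setIntegral_congr_fun measurableSet_Ioo fun x hx => h x hx.1 hx.2

lemma pow_val {a r : ℝ} (hr : -1 < r) :
    ∫ y in (0:ℝ)..a, (a - y) ^ r = a ^ (r + 1) / (r + 1) := by
  rw [intervalIntegral.integral_comp_sub_left (fun x => x ^ r)]
  rw [sub_self, sub_zero, integral_rpow (Or.inl hr), zero_rpow (by linarith), sub_zero]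

lemma pow_int {a b r : ℝ} (hr : -1 < r) :
    IntervalIntegrable (fun y => (a - y) ^ r) volume b a := by
  have := (intervalIntegral.intervalIntegrable_rpow' (a := a - b) (b := 0) hr).comp_sub_left a
  simpa using this

noncomputable def HH (d a x : ℝ) : ℝ :=
  ∫ y, ({p : ℝ × ℝ | 0 < p.2 ∧ p.2 < p.1}.indicator
    (fun p => (p.1 - p.2) ^ (-d) * (a - p.2) ^ (-d))) (x, y)

lemma HH_meas (d a : ℝ) : Measurable (HH d a) := by
  have : Measurable ({p : ℝ × ℝ | 0 < p.2 ∧ p.2 < p.1}.indicator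
    (fun p => (p.1 - p.2) ^ (-d) * (a - p.2) ^ (-d))) := by
    apply Measurable.indicator
    · fun_prop
    · exact MeasurableSet.inter (measurableSet_lt measurable_const measurable_snd)
        (measurableSet_lt measurable_snd measurable_fst)
  exact this.stronglyMeasurable.integral_prod_right'.measurable

lemma HH_eq (d a x : ℝ) (hx : 0 < x) :
    HH d a x = ∫ y in (0:ℝ)..x, (x - y) ^ (-d) * (a - y) ^ (-d) := by
  rw [intervalIntegral.integral_of_le hx.le,
        integral_Ioc_eq_integral_Ioo, ← integral_indicator measurableSet_Ioo]
  rfl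

lemma HH_nonneg (d a x : ℝ) (hx : 0 < x) (hxa : x < a) : 0 ≤ HH d a x := by
  rw [HH_eq d a x hx]
  apply intervalIntegral.integral_nonneg hx.le
  intro y hy
  have h1 : 0 ≤ x - y := by linarith [hy.2]
  have h2 : 0 ≤ a - y := by linarith [hy.2]
  positivity

lemma HH_le (d a x : ℝ) (h0 : 0 ≤ d) (h1 : d < 1/2) (hx : 0 < x) (hxa : x < a) :
    HH d a x ≤ a ^ (1 - 2 * d) / (1 - 2 * d) := by
  rw [HH_eq d a x hx]
  have e := pow_val (a := x) (r := -2 * d) (by linarith)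
  have hle : ∫ y in (0:ℝ)..x, (x - y) ^ (-d) * (a - y) ^ (-d) ≤
      ∫ y in (0:ℝ)..x, (x - y) ^ (-2 * d) := by
    rw [intervalIntegral.integral_of_le hx.le, intervalIntegral.integral_of_le hx.le,
      integral_Ioc_eq_integral_Ioo, integral_Ioc_eq_integral_Ioo]
    apply integral_mono_of_nonneg
    · refine (ae_restrict_iff' measurableSet_Ioo).2 (Filter.Eventually.of_forall fun y hy => ?_)
      have h1 : 0 ≤ x - y := by linarith [hy.2]
      have h2 : 0 ≤ a - y := by linarith [hy.2]
      simp only [Pi.zero_apply]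
      positivity
    · exact (intervalIntegrable_iff_integrableOn_Ioo_of_le hx.le).1 (pow_int (by linarith))
    · refine (ae_restrict_iff' measurableSet_Ioo).2 (Filter.Eventually.of_forall fun y hy => ?_)
      have h1 : 0 < x - y := by linarith [hy.2]
      simp only
      rw [show -2 * d = -d + -d by ring, rpow_add h1]
      apply mul_le_mul_of_nonneg_left _ (by positivity)
      exact rpow_le_rpow_of_nonpos h1 (by linarith) (by linarith)
  refine hle.trans ?_
  rw [e, show -2 * d + 1 = 1 - 2 * d by ring]
  have : 0 < 1 - 2 * d := by linarith
  gcongr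

lemma inner3 (d a : ℝ) (h0 : 0 ≤ d) (h1 : d < 1/2) (ha : 0 < a) :
    (∫ y2 in (0:ℝ)..a, ∫ y3 in (0:ℝ)..y2, ∫ y4 in (0:ℝ)..y3,
      (a - y2) ^ (-d) * (y2 - y3) ^ (-d) * (y3 - y4) ^ (-d) * (a - y4) ^ (-d)) =
    Gamma (1-d) ^ 3 / Gamma (3-3*d) * (a ^ (3 - 4 * d) / (3 - 4 * d)) := by
  have hg2 : 0 < Gamma (2 - 2 * d) := Gamma_pos_of_pos (by linarith)
  set B := Gamma (1 - d) * Gamma (1 - d) / Gamma (2 - 2 * d) with hB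
  set C := Gamma (1 - d) * Gamma (2 - 2 * d) / Gamma (3 - 3 * d) with hC
  have b1 : ∀ y, y < a → ∫ x in y..a, (a - x) ^ (-d) * (x - y) ^ (-d) =
      B * (a - y) ^ (1 - 2 * d) := by
    intro y hy
    have := beta_val (p := 1 - d) (q := 1 - d) (by linarith) (by linarith) hy
    rwa [show 1 - d - 1 = -d by ring, show 1 - d + (1 - d) = 2 - 2 * d by ring,
      show 2 - 2 * d - 1 = 1 - 2 * d by ring] at this
  have i1 : ∀ y, y < a → IntervalIntegrable (fun x => (a - x) ^ (-d) * (x - y) ^ (-d))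
      volume y a := by
    intro y hy
    have := beta_int (p := 1 - d) (q := 1 - d) (by linarith) (by linarith) hy
    rwa [show 1 - d - 1 = -d by ring] at this
  have b2 : ∀ y, y < a → ∫ x in y..a, (a - x) ^ (1 - 2 * d) * (x - y) ^ (-d) =
      C * (a - y) ^ (2 - 3 * d) := by
    intro y hy
    have := beta_val (p := 1 - d) (q := 2 - 2 * d) (by linarith) (by linarith) hy
    rwa [show 1 - d - 1 = -d by ring, show 2 - 2 * d - 1 = 1 - 2 * d by ring,
      show 1 - d + (2 - 2 * d) = 3 - 3 * d by ring,
      show 3 - 3 * d - 1 = 2 - 3 * d by ring] at this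
  have i2 : ∀ y, y < a → IntervalIntegrable (fun x => (a - x) ^ (1 - 2 * d) * (x - y) ^ (-d))
      volume y a := by
    intro y hy
    have := beta_int (p := 1 - d) (q := 2 - 2 * d) (by linarith) (by linarith) hy
    rwa [show 1 - d - 1 = -d by ring, show 2 - 2 * d - 1 = 1 - 2 * d by ring] at this
  have s1 : (∫ y2 in (0:ℝ)..a, ∫ y3 in (0:ℝ)..y2, ∫ y4 in (0:ℝ)..y3,
      (a - y2) ^ (-d) * (y2 - y3) ^ (-d) * (y3 - y4) ^ (-d) * (a - y4) ^ (-d)) =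
      ∫ y2 in (0:ℝ)..a, ∫ y3 in (0:ℝ)..y2,
        (a - y2) ^ (-d) * (y2 - y3) ^ (-d) * HH d a y3 := by
    apply icongr ha.le
    intro y2 h2 h2'
    apply icongr h2.le
    intro y3 h3 h3'
    rw [HH_eq d a y3 h3, ← intervalIntegral.integral_const_mul]
    congr 1
    ext y4
    ring
  have e1 : ∀ y, y < a → ∫ x in y..a, (a - x) ^ (-d) * (x - y) ^ (-d) * HH d a y =
      B * (a - y) ^ (1 - 2 * d) * HH d a y := by
    intro y hy
    rw [intervalIntegral.integral_mul_const, b1 y hy]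
  rw [s1, tri_swap ha.le (fun x y => (a - x) ^ (-d) * (x - y) ^ (-d) * HH d a y)]
  rotate_left
  · have := HH_meas d a
    unfold Function.uncurry
    fun_prop
  · intro x y hy hyx hxa
    have := HH_nonneg d a y hy (hyx.trans hxa)
    have h1 : 0 ≤ x - y := by linarith
    have h2 : 0 ≤ a - x := by linarith
    positivity
  · intro y hy hya
    exact (i1 y hya).mul_const _
  · rw [intervalIntegrable_iff_integrableOn_Ioo_of_le ha.le]
    have : IntegrableOn (fun y => B * (a - y) ^ (1 - 2 * d) * HH d a y) (Ioo 0 a) := by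
      apply Integrable.mul_bdd (c := a ^ (1 - 2 * d) / (1 - 2 * d))
      · exact ((intervalIntegrable_iff_integrableOn_Ioo_of_le ha.le).1
          ((pow_int (by linarith)).const_mul _))
      · exact (HH_meas d a).aestronglyMeasurable
      · refine (ae_restrict_iff' measurableSet_Ioo).2 (Filter.Eventually.of_forall fun y hy => ?_)
        rw [Real.norm_of_nonneg (HH_nonneg d a y hy.1 hy.2)]
        exact HH_le d a y h0 h1 hy.1 hy.2
    refine this.congr_fun (fun y hy => (e1 y hy.2).symm) measurableSet_Ioo
  have s2 : (∫ y in (0:ℝ)..a, ∫ x in y..a, (a - x) ^ (-d) * (x - y) ^ (-d) * HH d a y) =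
      B * ∫ x in (0:ℝ)..a, ∫ y in (0:ℝ)..x,
        (a - x) ^ (1 - 2 * d) * (x - y) ^ (-d) * (a - y) ^ (-d) := by
    rw [← intervalIntegral.integral_const_mul]
    apply icongr ha.le
    intro y hy hya
    rw [e1 y hya, HH_eq d a y hy, mul_assoc, ← intervalIntegral.integral_const_mul]
    congr 2
    ext z
    ring
  have e2 : ∀ y, y < a → ∫ x in y..a, (a - x) ^ (1 - 2 * d) * (x - y) ^ (-d) * (a - y) ^ (-d) =
      C * (a - y) ^ (2 - 4 * d) := by
    intro y hy
    rw [intervalIntegral.integral_mul_const, b2 y hy, mul_assoc, ← rpow_add (by linarith)]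
    ring_nf
  rw [s2, tri_swap ha.le (fun x y => (a - x) ^ (1 - 2 * d) * (x - y) ^ (-d) * (a - y) ^ (-d))]
  rotate_left
  · unfold Function.uncurry
    fun_prop
  · intro x y hy hyx hxa
    have h1 : 0 ≤ x - y := by linarith
    have h2 : 0 ≤ a - x := by linarith
    have h3 : 0 ≤ a - y := by linarith
    positivity
  · intro y hy hya
    exact (i2 y hya).mul_const _
  · rw [intervalIntegrable_iff_integrableOn_Ioo_of_le ha.le]
    have : IntegrableOn (fun y => C * (a - y) ^ (2 - 4 * d)) (Ioo 0 a) :=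
      ((intervalIntegrable_iff_integrableOn_Ioo_of_le ha.le).1
          ((pow_int (by linarith)).const_mul _))
    exact this.congr_fun (fun y hy => (e2 y hy.2).symm) measurableSet_Ioo
  rw [icongr ha.le (g := fun y => C * (a - y) ^ (2 - 4 * d)) (fun y _ hy => e2 y hy),
    intervalIntegral.integral_const_mul, pow_val (by linarith),
    show 2 - 4 * d + 1 = 3 - 4 * d by ring, hB, hC]
  generalize Gamma (2 - 2 * d) = g at *
  generalize Gamma (3 - 3 * d) = g'
  field_simp

theorem stmt3 (d : ℝ) (h0 : 0 ≤ d) (h1 : d < 1/2) :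
    (∫ y1 in (0:ℝ)..1, ∫ y2 in (0:ℝ)..y1, ∫ y3 in (0:ℝ)..y2, ∫ y4 in (0:ℝ)..y3,
      (y1 - y2) ^ (-d) * (y2 - y3) ^ (-d) * (y3 - y4) ^ (-d) * (y1 - y4) ^ (-d)) =
    Gamma (1-d) ^ 3 * Gamma (3-4*d) / (Gamma (3-3*d) * Gamma (5-4*d)) := by
  rw [icongr zero_le_one (fun a ha _ => inner3 d a h0 h1 ha),
    intervalIntegral.integral_const_mul, intervalIntegral.integral_div,
    integral_rpow (Or.inl (by linarith)), one_rpow, zero_rpow (by linarith),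
    show 5 - 4 * d = (3 - 4 * d + 1) + 1 by ring, Gamma_add_one (by linarith),
    Gamma_add_one (by linarith)]
  have hA : 0 < Gamma (3 - 4 * d) := Gamma_pos_of_pos (by linarith)
  have hB : 0 < Gamma (3 - 3 * d) := Gamma_pos_of_pos (by linarith)
  have hC : 0 < 3 - 4 * d := by linarith
  generalize Gamma (3 - 4 * d) = A at *
  generalize Gamma (3 - 3 * d) = B at *
  generalize 3 - 4 * d = c at *
  generalize Gamma (1 - d) = g
  have hD : 0 < c + 1 := by linarith
  field_simp
  ring
end

section
/- Let d be a real number with 0 ≤ d < 1/2. Then the iterated integral ∫₀¹∫₀^{y₁}∫₀^{y₂}∫₀^{y₃} (y₁−y₂)^(−d)(y₁−y₃)^(−d)(y₂−y₄)^(−d)(y₃−y₄)^(−d) dy₄ dy₃ dy₂ dy₁ equals Γ(1−d)⁴·Γ(3−4d)/(2·Γ(2−2d)²·Γ(5−4d)). -/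
open Real

open MeasureTheory Set

lemma aux_beta (d : ℝ) (h1 : d < 1/2) (c a : ℝ) (h : c < a) :
    ∫ y in c..a, (a - y) ^ (-d) * (y - c) ^ (-d)
      = (a - c) ^ (1 - 2*d) * (Gamma (1-d) ^ 2 / Gamma (2-2*d)) := by
  have hac : 0 < a - c := by linarith
  have e1 : ∫ y in c..a, (a - y) ^ (-d) * (y - c) ^ (-d)
      = ∫ x in (0:ℝ)..(a-c), x ^ (-d) * ((a - c) - x) ^ (-d) := by
    have := intervalIntegral.integral_comp_sub_right
      (fun x => x ^ (-d) * ((a - c) - x) ^ (-d)) c (a := c) (b := a)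
    rw [sub_self] at this
    rw [← this]
    congr 1
    ext y
    rw [show a - c - (y - c) = a - y by ring, mul_comm]
  rw [e1]
  have hb := Complex.betaIntegral_scaled ((1 - d : ℝ) : ℂ) ((1 - d : ℝ) : ℂ) hac
  rw [Complex.betaIntegral_eq_Gamma_mul_div _ _ (by simp; linarith) (by simp; linarith)] at hb
  apply Complex.ofReal_injective
  rw [← intervalIntegral.integral_ofReal]
  have e2 : ∫ x in (0:ℝ)..(a-c), ((x ^ (-d) * ((a - c) - x) ^ (-d) : ℝ) : ℂ)
      = ∫ x in (0:ℝ)..(a-c), (x : ℂ) ^ (((1 - d : ℝ) : ℂ) - 1) *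
        (((a - c : ℝ) : ℂ) - x) ^ (((1 - d : ℝ) : ℂ) - 1) := by
    apply intervalIntegral.integral_congr
    intro x hx
    rw [uIcc_of_le hac.le] at hx
    have e3 : ((1 - d : ℝ) : ℂ) - 1 = ((-d : ℝ) : ℂ) := by push_cast; ring
    simp only [e3]
    rw [Complex.ofReal_mul, Complex.ofReal_cpow hx.1, Complex.ofReal_cpow (by linarith [hx.2]),
      ← Complex.ofReal_sub]
  rw [e2, hb]
  rw [← Complex.ofReal_add, Complex.Gamma_ofReal, Complex.Gamma_ofReal,
    show ((1 - d + (1 - d) : ℝ) : ℂ) - 1 = ((1 - 2*d : ℝ) : ℂ) by push_cast; ring,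
    ← Complex.ofReal_cpow hac.le, show 1 - d + (1 - d) = 2 - 2*d by ring]
  push_cast
  ring

noncomputable def aphi (d a c y : ℝ) : ENNReal :=
  if c < y ∧ y < a then ENNReal.ofReal ((a - y) ^ (-d) * (y - c) ^ (-d)) else 0

noncomputable def aE (d a x y c : ℝ) : ENNReal :=
  if 0 < c ∧ y < x then aphi d a c x * aphi d a c y else 0

lemma aphi_meas (d : ℝ) : Measurable (fun p : ℝ × ℝ × ℝ => aphi d p.1 p.2.1 p.2.2) := by
  unfold aphi
  refine Measurable.ite ?_ (by fun_prop) (by fun_prop)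
  apply MeasurableSet.inter
  · exact measurableSet_lt (f := fun p : ℝ × ℝ × ℝ => p.2.1) (g := fun p => p.2.2)
      (by fun_prop) (by fun_prop)
  · exact measurableSet_lt (f := fun p : ℝ × ℝ × ℝ => p.2.2) (g := fun p => p.1)
      (by fun_prop) (by fun_prop)

lemma aE_meas (d : ℝ) : Measurable (fun p : ℝ × ℝ × ℝ × ℝ => aE d p.1 p.2.1 p.2.2.1 p.2.2.2) := by
  unfold aE
  refine Measurable.ite ?_ ?_ (by fun_prop)
  · apply MeasurableSet.inter
    · exact measurableSet_lt (f := fun _ : ℝ × ℝ × ℝ × ℝ => (0:ℝ)) (g := fun p => p.2.2.2)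
        (by fun_prop) (by fun_prop)
    · exact measurableSet_lt (f := fun p : ℝ × ℝ × ℝ × ℝ => p.2.2.1) (g := fun p => p.2.1)
        (by fun_prop) (by fun_prop)
  · exact ((aphi_meas d).comp (f := fun p : ℝ × ℝ × ℝ × ℝ => (p.1, p.2.2.2, p.2.1))
      (by fun_prop)).mul
      ((aphi_meas d).comp (f := fun p : ℝ × ℝ × ℝ × ℝ => (p.1, p.2.2.2, p.2.2.1)) (by fun_prop))

lemma aux_lint (F : ℝ → ENNReal) (f : ℝ → ℝ) (p q : ℝ) (hpq : p ≤ q) (hF : Measurable F)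
    (h0 : ∀ y, ¬ (p < y ∧ y < q) → F y = 0) (hfin : ∀ᵐ y, F y < ⊤)
    (hf : ∀ᵐ y, p < y → y < q → f y = (F y).toReal) :
    ∫ y in p..q, f y = (∫⁻ y, F y).toReal := by
  rw [intervalIntegral.integral_of_le hpq, integral_Ioc_eq_integral_Ioo,
    ← integral_indicator measurableSet_Ioo, ← integral_toReal hF.aemeasurable hfin]
  apply integral_congr_ae
  filter_upwards [hf] with y hy
  by_cases h : p < y ∧ y < q
  · rw [indicator_of_mem (show y ∈ Ioo p q from h), hy h.1 h.2]
  · rw [indicator_of_notMem (show y ∉ Ioo p q from h), h0 y h]; simp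

lemma aux_lint_pos (f : ℝ → ℝ) (p q : ℝ) (hpq : p ≤ q)
    (hf : ∀ y, p < y → y < q → 0 ≤ f y) (hI : IntervalIntegrable f volume p q) :
    ∫⁻ y, (if p < y ∧ y < q then ENNReal.ofReal (f y) else 0)
      = ENNReal.ofReal (∫ y in p..q, f y) := by
  have hI' : IntegrableOn f (Ioo p q) :=
    ((intervalIntegrable_iff_integrableOn_Ioc_of_le hpq).1 hI).mono_set Ioo_subset_Ioc_self
  rw [intervalIntegral.integral_of_le hpq, integral_Ioc_eq_integral_Ioo,
    ofReal_integral_eq_lintegral_ofReal hI', ← lintegral_indicator measurableSet_Ioo]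
  · apply lintegral_congr
    intro y
    by_cases h : p < y ∧ y < q
    · rw [indicator_of_mem (show y ∈ Ioo p q from h), if_pos h]
    · rw [indicator_of_notMem (show y ∉ Ioo p q from h), if_neg h]
  · filter_upwards [ae_restrict_mem measurableSet_Ioo] with y hy using hf y hy.1 hy.2

lemma aphi_int (d : ℝ) (h1 : d < 1/2) (c a : ℝ) (h : c < a) :
    ∫⁻ y, aphi d a c y
      = ENNReal.ofReal ((a - c) ^ (1 - 2*d) * (Gamma (1-d) ^ 2 / Gamma (2-2*d))) := by
  have hb := aux_beta d h1 c a h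
  rw [← hb]
  refine aux_lint_pos _ c a h.le (fun y hy hy' => ?_) ?_
  · exact mul_nonneg (rpow_nonneg (by linarith) _) (rpow_nonneg (by linarith) _)
  · by_contra hn
    rw [intervalIntegral.integral_undef hn] at hb
    have h2 : 0 < (a - c) ^ (1 - 2*d) * (Gamma (1-d) ^ 2 / Gamma (2-2*d)) := by
      have := Gamma_pos_of_pos (show 0 < 1 - d by linarith)
      have := Gamma_pos_of_pos (show 0 < 2 - 2*d by linarith)
      have := rpow_pos_of_pos (sub_pos.2 h) (1 - 2*d)
      positivity
    linarith

lemma aux_symm (φ : ℝ → ENNReal) (hφ : Measurable φ) :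
    2 * ∫⁻ x, ∫⁻ y, (if y < x then φ x * φ y else 0) = (∫⁻ x, φ x) ^ 2 := by
  have hm : Measurable (fun p : ℝ × ℝ => if p.2 < p.1 then φ p.1 * φ p.2 else 0) := by
    refine Measurable.ite (measurableSet_lt (by fun_prop) (by fun_prop)) (by fun_prop) (by fun_prop)
  have hs : ∫⁻ x, ∫⁻ y, (if y < x then φ x * φ y else 0)
      = ∫⁻ x, ∫⁻ y, (if x < y then φ x * φ y else 0) := by
    rw [lintegral_lintegral_swap hm.aemeasurable]
    simp_rw [mul_comm]
  rw [two_mul]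
  nth_rewrite 2 [hs]
  rw [← lintegral_add_left (Measurable.lintegral_prod_right' hm), sq, ← lintegral_mul_const _ hφ]
  congr 1
  ext x
  rw [← lintegral_add_left (by exact hm.comp (measurable_const.prodMk measurable_id)),
    ← lintegral_const_mul _ hφ]
  apply lintegral_congr_ae
  filter_upwards [Measure.ae_ne volume x] with y hy
  rcases lt_or_gt_of_ne hy with h | h
  · simp [h, h.not_gt]
  · simp [h, h.not_gt]

noncomputable def aK (d : ℝ) : ℝ := (Gamma (1-d) ^ 2 / Gamma (2-2*d)) ^ 2 / 2

lemma aC (d : ℝ) (h1 : d < 1/2) (a : ℝ) (ha : 0 < a) :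
    ∫⁻ x, ∫⁻ y, ∫⁻ c, aE d a x y c = ENNReal.ofReal (aK d * (a ^ (3 - 4*d) / (3 - 4*d))) := by
  have e1 : ∫⁻ x, ∫⁻ y, ∫⁻ c, aE d a x y c = ∫⁻ c, ∫⁻ x, ∫⁻ y, aE d a x y c := by
    have : ∀ x, ∫⁻ y, ∫⁻ c, aE d a x y c = ∫⁻ c, ∫⁻ y, aE d a x y c := by
      intro x
      apply lintegral_lintegral_swap
      exact ((aE_meas d).comp (f := fun p : ℝ × ℝ => (a, x, p.1, p.2)) (by fun_prop)).aemeasurable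
    simp_rw [this]
    apply lintegral_lintegral_swap
    apply Measurable.aemeasurable
    exact Measurable.lintegral_prod_right' (f := fun p : (ℝ × ℝ) × ℝ => aE d a p.1.1 p.2 p.1.2)
      ((aE_meas d).comp (f := fun p : (ℝ × ℝ) × ℝ => (a, p.1.1, p.2, p.1.2)) (by fun_prop))
  rw [e1]
  have e2 : ∀ c, ∫⁻ x, ∫⁻ y, aE d a x y c
      = if 0 < c ∧ c < a then ENNReal.ofReal (aK d * (a - c) ^ (2 - 4*d)) else 0 := by
    intro c
    by_cases hc : 0 < c
    swap
    · simp [aE, hc]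
    have hs := aux_symm (aphi d a c) ((aphi_meas d).comp
      (f := fun y : ℝ => (a, c, y)) (by fun_prop))
    by_cases hca : c < a
    swap
    · have : ∀ x, aphi d a c x = 0 := by
        intro x
        unfold aphi
        rw [if_neg]
        rintro ⟨h, h'⟩
        linarith
      simp [aE, this, hca]
    rw [if_pos ⟨hc, hca⟩]
    rw [aphi_int d h1 c a hca] at hs
    simp only [aE, hc, true_and]
    have hac : 0 < a - c := sub_pos.2 hca
    have hB : 0 ≤ Gamma (1-d) ^ 2 / Gamma (2-2*d) := by
      have := Gamma_pos_of_pos (show 0 < 2 - 2*d by linarith)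
      positivity
    have h2 : ENNReal.ofReal ((a - c) ^ (1 - 2*d) * (Gamma (1-d) ^ 2 / Gamma (2-2*d))) ^ 2
        = 2 * ENNReal.ofReal (aK d * (a - c) ^ (2 - 4*d)) := by
      rw [← ENNReal.ofReal_pow (mul_nonneg (rpow_nonneg hac.le _) hB),
        show (2:ENNReal) = ENNReal.ofReal 2 by simp, ← ENNReal.ofReal_mul (by norm_num)]
      congr 1
      rw [show 2 - 4*d = (1 - 2*d) + (1 - 2*d) by ring, rpow_add hac, aK]
      ring
    rw [h2] at hs
    exact (ENNReal.mul_right_inj (by norm_num) (by norm_num)).1 hs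
  simp_rw [e2]
  have hi : ∫ c in (0:ℝ)..a, aK d * (a - c) ^ (2 - 4*d) = aK d * (a ^ (3 - 4*d) / (3 - 4*d)) := by
    rw [intervalIntegral.integral_const_mul,
      intervalIntegral.integral_comp_sub_left (fun x => x ^ (2 - 4*d)) a,
      integral_rpow (Or.inl (by linarith)), sub_self, sub_zero,
      show 2 - 4*d + 1 = 3 - 4*d by ring, zero_rpow (by linarith), sub_zero]
  have hK : 0 ≤ aK d := by unfold aK; positivity
  rw [aux_lint_pos _ 0 a ha.le _ _, hi]
  · intro y _ hy
    exact mul_nonneg hK (rpow_nonneg (by linarith) _)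
  · apply IntervalIntegrable.const_mul
    have := (intervalIntegral.intervalIntegrable_rpow' (a := a) (b := 0)
      (show -1 < 2 - 4*d by linarith)).comp_sub_left a
    simpa using this

lemma aE_zero (d a x y c : ℝ) (h : ¬ (0 < c ∧ c < y ∧ y < x ∧ x < a)) : aE d a x y c = 0 := by
  unfold aE aphi
  by_cases h1 : 0 < c ∧ y < x
  · rw [if_pos h1]
    by_cases h2 : c < x ∧ x < a
    · by_cases h3 : c < y ∧ y < a
      · exact absurd ⟨h1.1, h3.1, h1.2, h2.2⟩ h
      · rw [if_neg h3, mul_zero]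
    · rw [if_neg h2, zero_mul]
  · rw [if_neg h1]

lemma level1 (d : ℝ) (h1 : d < 1/2) (a : ℝ) (ha : 0 < a) :
    (∫ x in (0:ℝ)..a, ∫ y in (0:ℝ)..x, ∫ c in (0:ℝ)..y,
      (a - x) ^ (-d) * (a - y) ^ (-d) * (x - c) ^ (-d) * (y - c) ^ (-d))
      = aK d * (a ^ (3 - 4*d) / (3 - 4*d)) := by
  have mA : Measurable (fun p : ℝ × ℝ => ∫⁻ c, aE d a p.1 p.2 c) :=
    Measurable.lintegral_prod_right' (f := fun p : (ℝ × ℝ) × ℝ => aE d a p.1.1 p.1.2 p.2)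
      ((aE_meas d).comp (f := fun p : (ℝ × ℝ) × ℝ => (a, p.1.1, p.1.2, p.2)) (by fun_prop))
  have mB : Measurable (fun x : ℝ => ∫⁻ y, ∫⁻ c, aE d a x y c) :=
    Measurable.lintegral_prod_right' mA
  have hC := aC d h1 a ha
  have hK : 0 ≤ aK d := by unfold aK; positivity
  have hfB : ∀ᵐ x, ∫⁻ y, ∫⁻ c, aE d a x y c < ⊤ := by
    apply ae_lt_top mB
    rw [hC]; exact ENNReal.ofReal_ne_top
  have l3 : ∀ x y, 0 < y → y < x → x < a → ∫ c in (0:ℝ)..y,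
      (a - x) ^ (-d) * (a - y) ^ (-d) * (x - c) ^ (-d) * (y - c) ^ (-d)
      = (∫⁻ c, aE d a x y c).toReal := by
    intro x y hy hyx hxa
    apply aux_lint _ _ 0 y hy.le
    · exact (aE_meas d).comp (f := fun c : ℝ => (a, x, y, c)) (by fun_prop)
    · intro c hc
      apply aE_zero
      tauto
    · refine Filter.Eventually.of_forall fun c => ?_
      unfold aE aphi
      split_ifs <;> simp [ENNReal.mul_lt_top]
    · refine Filter.Eventually.of_forall fun c hc hcy => ?_
      unfold aE aphi
      rw [if_pos ⟨hc, hyx⟩, if_pos ⟨by linarith, hxa⟩, if_pos ⟨hcy, by linarith⟩,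
        ENNReal.toReal_mul, ENNReal.toReal_ofReal, ENNReal.toReal_ofReal]
      · ring
      · exact mul_nonneg (rpow_nonneg (by linarith) _) (rpow_nonneg (by linarith) _)
      · exact mul_nonneg (rpow_nonneg (by linarith) _) (rpow_nonneg (by linarith) _)
  have l2 : ∀ x, 0 < x → x < a → ∫⁻ y, ∫⁻ c, aE d a x y c < ⊤ →
      ∫ y in (0:ℝ)..x, ∫ c in (0:ℝ)..y,
      (a - x) ^ (-d) * (a - y) ^ (-d) * (x - c) ^ (-d) * (y - c) ^ (-d)
      = (∫⁻ y, ∫⁻ c, aE d a x y c).toReal := by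
    intro x hx hxa hfin
    have mA' : Measurable (fun y : ℝ => ∫⁻ c, aE d a x y c) :=
      mA.comp (f := fun y : ℝ => (x, y)) (by fun_prop)
    apply aux_lint _ _ 0 x hx.le mA'
    · intro y hy
      rw [lintegral_congr (fun c => aE_zero d a x y c ?_)]
      · simp
      · rintro ⟨h1, h2, h3, h4⟩
        exact hy ⟨by linarith, h3⟩
    · exact ae_lt_top mA' hfin.ne
    · exact Filter.Eventually.of_forall fun y hy hyx => l3 x y hy hyx hxa
  rw [aux_lint (fun x => ∫⁻ y, ∫⁻ c, aE d a x y c) _ 0 a ha.le mB _ hfB _, hC,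
    ENNReal.toReal_ofReal]
  · exact mul_nonneg hK (div_nonneg (rpow_nonneg ha.le _) (by linarith))
  · intro x hx
    have : ∀ y c, aE d a x y c = 0 := by
      intro y c
      apply aE_zero
      rintro ⟨h1, h2, h3, h4⟩
      exact hx ⟨by linarith, h4⟩
    simp [this]
  · filter_upwards [hfB] with x hx h h'
    exact l2 x h h' hx

theorem stmt4 (d : ℝ) (h0 : 0 ≤ d) (h1 : d < 1/2) :
    (∫ y1 in (0:ℝ)..1, ∫ y2 in (0:ℝ)..y1, ∫ y3 in (0:ℝ)..y2, ∫ y4 in (0:ℝ)..y3,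
      (y1 - y2) ^ (-d) * (y1 - y3) ^ (-d) * (y2 - y4) ^ (-d) * (y3 - y4) ^ (-d)) =
    Gamma (1-d) ^ 4 * Gamma (3-4*d) / (2 * Gamma (2-2*d) ^ 2 * Gamma (5-4*d)) := by
  have e : (∫ y1 in (0:ℝ)..1, ∫ y2 in (0:ℝ)..y1, ∫ y3 in (0:ℝ)..y2, ∫ y4 in (0:ℝ)..y3,
      (y1 - y2) ^ (-d) * (y1 - y3) ^ (-d) * (y2 - y4) ^ (-d) * (y3 - y4) ^ (-d))
      = ∫ a in (0:ℝ)..1, aK d * (a ^ (3 - 4*d) / (3 - 4*d)) := by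
    rw [intervalIntegral.integral_of_le zero_le_one, intervalIntegral.integral_of_le zero_le_one]
    exact setIntegral_congr_fun measurableSet_Ioc fun a ha => level1 d h1 a ha.1
  rw [e, intervalIntegral.integral_const_mul, intervalIntegral.integral_div,
    integral_rpow (Or.inl (by linarith)), zero_rpow (by linarith), one_rpow,
    show 5 - 4*d = (3 - 4*d + 1) + 1 by ring, Gamma_add_one (by linarith),
    Gamma_add_one (by linarith), aK]
  have g1 := (Gamma_pos_of_pos (show 0 < 2 - 2*d by linarith)).ne'
  have g2 := (Gamma_pos_of_pos (show 0 < 3 - 4*d by linarith)).ne'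
  have g3 : 3 - 4*d ≠ 0 := by linarith
  have g4 : 3 - 4*d + 1 ≠ 0 := by linarith
  generalize Gamma (2 - 2*d) = A at *
  generalize Gamma (3 - 4*d) = B at *
  generalize Gamma (1 - d) = C at *
  clear e
  generalize 3 - 4*d = t at *
  field_simp
  ring
end
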